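/- arXiv:1405.4993 — 2 statements merged into one kernel-verified Lean document; each statement's English description precedes it below -/
import Mathlib

section
/- Let K be an o-symmetric convex body in ℝ^n, let Λ be a lattice of rank n in ℝ^n, and write λ_i = λ_i(K,Λ) for 1 ≤ i ≤ n. Then S(K)/(D_min(Λ^⋆)·det Λ) ≥ (2^n/(n−1)!)·√(σ_{n−1}(λ_1^{−2},…,λ_n^{−2})), where Λ^⋆ is the polar lattice of Λ. -/
open MeasureTheory Set Filter Pointwise RealInnerProductSpace
open scoped ENNReal

noncomputable section

namespace Paper

/-- Euclidean space `ℝ^n`. -/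
abbrev Euc (n : ℕ) := EuclideanSpace ℝ (Fin n)

variable {n : ℕ}

/-- A convex body: a compact convex set with non-empty interior. -/
def IsConvexBody (K : Set (Euc n)) : Prop :=
  Convex ℝ K ∧ IsCompact K ∧ (interior K).Nonempty

/-- The centroid of `K` lies at the origin, i.e. `∫_K x dx = 0`. -/
def CentroidAtOrigin (K : Set (Euc n)) : Prop :=
  (∫ x in K, x) = (0 : Euc n)

/-- The lattice generated by the family `b`. -/
def latticeOf (b : Fin n → Euc n) : Set (Euc n) :=
  {x | ∃ z : Fin n → ℤ, x = ∑ i, (z i : ℝ) • b i}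

/-- The determinant of the lattice generated by `b`. -/
def latticeDet (b : Fin n → Euc n) : ℝ :=
  |Matrix.det (Matrix.of fun i j => b j i)|

/-- The integer lattice `ℤ^n` inside `ℝ^n`. -/
def stdLattice (n : ℕ) : Set (Euc n) :=
  {x | ∀ i, ∃ m : ℤ, x i = (m : ℝ)}

/-- `succMin K Λ i` is the `i`-th successive minimum
`λ_i(K,Λ) = inf {t > 0 : t•K contains at least i linearly independent points of Λ}`. -/
def succMin (K Λ : Set (Euc n)) (i : ℕ) : ℝ :=
  sInf {t : ℝ | 0 < t ∧ ∃ v : Fin i → Euc n,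
    LinearIndependent ℝ v ∧ ∀ j, v j ∈ Λ ∧ v j ∈ t • K}

/-- Surface area of a convex body, via the (outer) Minkowski content. -/
def surfaceArea (K : Set (Euc n)) : ℝ :=
  limUnder (nhdsWithin (0 : ℝ) (Ioi 0)) fun ε =>
    ((volume (Metric.cthickening ε K)).toReal - (volume K).toReal) / ε

/-- The `k`-th elementary symmetric function of `ρ 0, …, ρ (n-1)`. -/
def esym (n k : ℕ) (ρ : Fin n → ℝ) : ℝ :=
  ∑ J ∈ Finset.powersetCard k (Finset.univ : Finset (Fin n)), ∏ i ∈ J, ρ i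

/-- A rational polytope: convex hull of finitely many points with rational coordinates. -/
def IsRationalPolytope (P : Set (Euc n)) : Prop :=
  ∃ V : Finset (Euc n), (∀ v ∈ V, ∀ i, ∃ q : ℚ, v i = (q : ℝ)) ∧
    P = convexHull ℝ (V : Set (Euc n))

/-- A lattice polytope: convex hull of finitely many points of `ℤ^n`. -/
def IsLatticePolytope (P : Set (Euc n)) : Prop :=
  ∃ V : Finset (Euc n), (∀ v ∈ V, v ∈ stdLattice n) ∧
    P = convexHull ℝ (V : Set (Euc n))

/-- `F` is a facet of `P`: an `(n-1)`-dimensional face cut out by a supporting hyperplane. -/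
def IsFacet (P F : Set (Euc n)) : Prop :=
  ∃ (a : Euc n) (b : ℝ), a ≠ 0 ∧ (∀ x ∈ P, ⟪a, x⟫ ≤ b) ∧
    F = {x | x ∈ P ∧ ⟪a, x⟫ = b} ∧
    Module.finrank ℝ (affineSpan ℝ F).direction = n - 1

/-- The determinant of a `k`-dimensional lattice `L ⊆ ℝ^n` (given as a set of points):
the square root of the Gram determinant of any ℤ-basis of `L`. -/
def sublatticeDetOf (k : ℕ) (L : Set (Euc n)) : ℝ :=
  sInf {d : ℝ | ∃ c : Fin k → Euc n, LinearIndependent ℝ c ∧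
    L = {x | ∃ z : Fin k → ℤ, x = ∑ i, (z i : ℝ) • c i} ∧
    d = Real.sqrt (Matrix.det (Matrix.of fun i j => ⟪c i, c j⟫))}

/-- The lattice surface area
`lE_{n-1}(P) = (1/2) ∑_{F facet of P} vol_{n-1}(F) / det(aff₀(F) ∩ ℤ^n)`,
where `vol_{n-1}` is realized by the `(n-1)`-dimensional Hausdorff measure. -/
def latticeSurfaceArea (P : Set (Euc n)) : ℝ :=
  (1/2) * ∑ᶠ F ∈ {F : Set (Euc n) | IsFacet P F},
    (μH[(n : ℝ) - 1] F).toReal /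
      sublatticeDetOf (n - 1) (((affineSpan ℝ F).direction : Set (Euc n)) ∩ stdLattice n)

/-- `D_i(Λ)`: the minimal determinant of an `i`-dimensional sublattice of `Λ`. -/
def minSublatticeDet (Λ : Set (Euc n)) (i : ℕ) : ℝ :=
  sInf {d : ℝ | ∃ c : Fin i → Euc n, LinearIndependent ℝ c ∧ (∀ j, c j ∈ Λ) ∧
    d = Real.sqrt (Matrix.det (Matrix.of fun k l => ⟪c k, c l⟫))}

/-- `D_min(Λ) = min {D_i(Λ)^(1/i) : 1 ≤ i ≤ n}`. -/
def Dmin (Λ : Set (Euc n)) : ℝ :=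
  sInf {d : ℝ | ∃ i : Fin n, d = minSublatticeDet Λ ((i : ℕ) + 1) ^ ((1 : ℝ) / ((i : ℕ) + 1))}

/-- The polar lattice `Λ^⋆ = {x : ⟨x,y⟩ ∈ ℤ for all y ∈ Λ}`. -/
def polarLattice (Λ : Set (Euc n)) : Set (Euc n) :=
  {x | ∀ y ∈ Λ, ∃ m : ℤ, ⟪x, y⟫ = (m : ℝ)}

/-- The standard cross-polytope `C_n^⋆ = conv{±e_1, …, ±e_n}`. -/
def crossPolytope (n : ℕ) : Set (Euc n) :=
  convexHull ℝ ((Set.range fun i : Fin n => EuclideanSpace.single i (1 : ℝ)) ∪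
    (Set.range fun i : Fin n => -EuclideanSpace.single i (1 : ℝ)))

/-- The standard simplex `S_n = conv{0, e_1, …, e_n}`. -/
def stdSimplexSet (n : ℕ) : Set (Euc n) :=
  convexHull ℝ (insert 0 (Set.range fun i : Fin n => EuclideanSpace.single i (1 : ℝ)))

/-- The all-ones vector `𝟙 = (1,…,1)`. -/
def allOnes (n : ℕ) : Euc n := WithLp.toLp 2 fun _ => (1 : ℝ)

/-- The simplex `T_n = -𝟙 + (n+1) S_n`. -/
def Tn (n : ℕ) : Set (Euc n) :=
  (fun x => ((n : ℝ) + 1) • x - allOnes n) '' stdSimplexSet n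


lemma aux_limit (g : ℝ → ℝ) (c : ℝ) (hc : ∀ h > 0, c ≤ g h / h) (g0 : ∀ h > 0, 0 ≤ g h)
    (hg : ∀ a > 0, ∀ b > 0, g a + g b ≤ g (a + b)) :
    ∃ L, c ≤ L ∧ Tendsto (fun h => g h / h) (nhdsWithin (0 : ℝ) (Ioi 0)) (nhds L) := by
  set S : Set ℝ := (fun h => g h / h) '' Ioi 0 with hS
  have hne : S.Nonempty := ⟨_, 1, by simp, rfl⟩
  have hbdd : BddBelow S := ⟨c, by rintro _ ⟨h, hh, rfl⟩; exact hc h hh⟩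
  refine ⟨sInf S, le_csInf hne (by rintro _ ⟨h, hh, rfl⟩; exact hc h hh), ?_⟩
  have hmul : ∀ k : ℕ, ∀ η > 0, ((k : ℝ) + 1) * g η ≤ g (((k : ℝ) + 1) * η) := by
    intro k η hη
    induction k with
    | zero => simp
    | succ k ih =>
      have := hg (((k : ℝ) + 1) * η) (by positivity) η hη
      push_cast
      have e : ((k : ℝ) + 1 + 1) * η = (k + 1) * η + η := by ring
      rw [e]; linarith
  have hmono : ∀ a > 0, ∀ b, a ≤ b → g a ≤ g b := by
    intro a ha b hab
    rcases hab.eq_or_lt with rfl | hlt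
    · exact le_rfl
    · have := hg a ha (b - a) (by linarith)
      have := g0 (b - a) (by linarith)
      simp at *; linarith
  have key : ∀ h > 0, ∀ η > 0, η < h → (1 - η / h) * (g η / η) ≤ g h / h := by
    intro h hh η hη hlt
    obtain ⟨k, hk⟩ : ∃ k : ℕ, ⌊h / η⌋₊ = k + 1 := by
      apply Nat.exists_eq_succ_of_ne_zero
      have : 1 ≤ ⌊h / η⌋₊ := by
        rw [Nat.one_le_floor_iff]
        rw [le_div_iff₀ hη]; linarith
      omega
    have h1 : ((k : ℝ) + 1) ≤ h / η := by
      have := Nat.floor_le (show 0 ≤ h / η by positivity)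
      rw [hk] at this; push_cast at this; exact this
    have h2 : h / η < (k : ℝ) + 1 + 1 := by
      have := Nat.lt_floor_add_one (h / η)
      rw [hk] at this; push_cast at this; exact this
    have h3 := hmul k η hη
    have h4 := hmono (((k : ℝ) + 1) * η) (by positivity) h (by rwa [le_div_iff₀ hη] at h1)
    have h5 := g0 η hη
    rw [le_div_iff₀ hh]
    have e : (1 - η / h) * (g η / η) * h = (h / η - 1) * g η := by field_simp
    rw [e]
    nlinarith
  rw [Metric.tendsto_nhdsWithin_nhds]
  intro e he
  set L := sInf S
  obtain ⟨_, ⟨h0, hh0, rfl⟩, hlt⟩ := Real.lt_sInf_add_pos hne (half_pos he)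
  have hh0' : 0 < h0 := hh0
  simp only at hlt
  have hcont : Tendsto (fun η : ℝ => (1 - η / h0) * (L + e)) (nhds 0) (nhds ((1 - 0 / h0) * (L + e))) := by
    apply Continuous.tendsto
    fun_prop
  have hev : ∀ᶠ η in nhds (0 : ℝ), L + e / 2 < (1 - η / h0) * (L + e) := by
    apply hcont.eventually_const_lt
    simp; linarith
  rw [Metric.eventually_nhds_iff] at hev
  obtain ⟨d, hd, hd'⟩ := hev
  refine ⟨min d h0, lt_min hd hh0', fun {η} hη hdist => ?_⟩
  have hη' : 0 < η := hη
  have hη2 : η < h0 := by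
    have := lt_of_lt_of_le hdist (min_le_right _ _)
    rw [Real.dist_eq] at this; simp at this; linarith [le_abs_self η]
  have k1 := key h0 hh0' η hη' hη2
  have k2 := hd' (lt_of_lt_of_le hdist (min_le_left _ _))
  have k3 : L ≤ g η / η := csInf_le hbdd ⟨η, hη, rfl⟩
  rw [Real.dist_eq, abs_lt]
  constructor
  · linarith
  · have pos : 0 < 1 - η / h0 := by
      rw [sub_pos, div_lt_one hh0']; exact hη2
    have : (1 - η / h0) * (g η / η) < (1 - η / h0) * (L + e) := by
      change g h0 / h0 < L + e / 2 at hlt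
      linarith
    have := lt_of_mul_lt_mul_left this pos.le
    linarith

lemma aux_proj {K : Set (Euc n)} (hc : Convex ℝ K) (hk : IsCompact K) (hne : K.Nonempty)
    (x : Euc n) : ∃ p ∈ K, ∀ w ∈ K, ⟪x - p, w - p⟫ ≤ 0 := by
  obtain ⟨p, hp, h⟩ := exists_norm_eq_iInf_of_complete_convex hne hk.isComplete hc x
  exact ⟨p, hp, (norm_eq_iInf_iff_real_inner_le_zero hc hp).1 h⟩

lemma aux_infDist {K : Set (Euc n)} {x p : Euc n} (hp : p ∈ K)
    (h : ∀ w ∈ K, ⟪x - p, w - p⟫ ≤ 0) : Metric.infDist x K = ‖x - p‖ := by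
  apply le_antisymm
  · rw [← dist_eq_norm]; exact Metric.infDist_le_dist_of_mem hp
  · rw [Metric.le_infDist ⟨p, hp⟩]
    intro w hw
    rw [dist_eq_norm]
    have h1 := h w hw
    have e : x - w = (x - p) - (w - p) := by abel
    have : ‖x - p‖ ^ 2 ≤ ‖x - w‖ ^ 2 := by
      rw [e, norm_sub_sq_real (x - p) (w - p)]; nlinarith [sq_nonneg ‖w - p‖]
    exact (abs_le_of_sq_le_sq' this (norm_nonneg _)).2

lemma aux_mem_cth {K : Set (Euc n)} (hne : K.Nonempty) {e : ℝ} (he : 0 ≤ e) (x : Euc n) :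
    x ∈ Metric.cthickening e K ↔ Metric.infDist x K ≤ e := by
  rw [Metric.mem_cthickening_iff, Metric.infDist,
    ENNReal.le_ofReal_iff_toReal_le (Metric.infEDist_ne_top hne) he]

lemma aux_expand (φ : Euc n → Euc n) (h : ∀ x y, ‖x - y‖ ≤ ‖φ x - φ y‖) (s : Set (Euc n)) :
    volume s ≤ volume (φ '' s) := by
  have ha : AntilipschitzWith 1 φ := by
    apply AntilipschitzWith.of_le_mul_dist
    intro x y
    simpa [dist_eq_norm] using h x y
  have h2 := ha.le_hausdorffMeasure_image (d := (n : ℝ)) (by positivity) s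
  have : (Measure.hausdorffMeasure (n : ℝ) : Measure (Euc n)).IsAddHaarMeasure := by
    simpa using MeasureTheory.isAddHaarMeasure_hausdorffMeasure (E := EuclideanSpace ℝ (Fin n))
  rw [Measure.isAddLeftInvariant_eq_smul (volume : Measure (Euc n))
    (Measure.hausdorffMeasure (n : ℝ))]
  simp only [Measure.smul_apply]
  simp at h2
  gcongr

lemma aux_super {K : Set (Euc n)} (hc : Convex ℝ K) (hk : IsCompact K) (hne : K.Nonempty)
    {a b : ℝ} (ha : 0 < a) (hb : 0 < b) :
    ((volume (Metric.cthickening a K)).toReal - (volume K).toReal)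
      + ((volume (Metric.cthickening b K)).toReal - (volume K).toReal) ≤
    (volume (Metric.cthickening (a + b) K)).toReal - (volume K).toReal := by
  choose p hp hpi using aux_proj hc hk hne
  let u : Euc n → Euc n := fun x => ‖x - p x‖⁻¹ • (x - p x)
  have hu : ∀ x, x = p x + ‖x - p x‖ • u x := by
    intro x
    by_cases h : ‖x - p x‖ = 0
    · rw [h]; simp; rwa [norm_eq_zero, sub_eq_zero] at h
    · simp only [u, smul_smul, mul_inv_cancel₀ h]; simp
  have hu1 : ∀ x, ‖x - p x‖ ≠ 0 → ‖u x‖ = 1 := by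
    intro x h
    simp [u, norm_smul, h]
  have hule : ∀ x, ‖u x‖ ≤ 1 := by
    intro x
    by_cases h : ‖x - p x‖ = 0
    · simp [u, h]
    · exact (hu1 x h).le
  have hus : ∀ x, ‖x - p x‖ * ‖u x‖ ^ 2 = ‖x - p x‖ := by
    intro x
    by_cases h : ‖x - p x‖ = 0
    · simp [h]
    · simp [hu1 x h]
  have hun : ∀ x, ∀ w ∈ K, ⟪u x, w - p x⟫ ≤ 0 := by
    intro x w hw
    simp only [u, real_inner_smul_left]
    exact mul_nonpos_of_nonneg_of_nonpos (by positivity) (hpi x w hw)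
  have mono : ∀ x y, 0 ≤ ⟪x - y, u x - u y⟫ := by
    intro x y
    have h1 := hun x (p y) (hp y)
    have h2 := hun y (p x) (hp x)
    have e : ⟪x - y, u x - u y⟫ = -⟪u x, p y - p x⟫ - ⟪u y, p x - p y⟫
        + (‖x - p x‖ * ‖u x‖ ^ 2 + ‖y - p y‖ * ‖u y‖ ^ 2
          - (‖x - p x‖ + ‖y - p y‖) * ⟪u x, u y⟫) := by
      have e0 : x - y = (p x - p y) + (‖x - p x‖ • u x - ‖y - p y‖ • u y) := by
        nth_rewrite 1 [hu x]
        nth_rewrite 1 [hu y]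
        abel
      rw [e0]
      simp only [inner_add_left, inner_sub_left, inner_sub_right, real_inner_smul_left,
        real_inner_self_eq_norm_sq]
      rw [real_inner_comm (u x) (p x), real_inner_comm (u x) (p y), real_inner_comm (u y) (p x),
        real_inner_comm (u y) (p y), real_inner_comm (u x) (u y)]
      ring
    rw [e, hus, hus]
    have h3 : ⟪u x, u y⟫ ≤ 1 := by
      have := real_inner_le_norm (u x) (u y)
      nlinarith [hule x, hule y, norm_nonneg (u x), norm_nonneg (u y)]
    nlinarith [norm_nonneg (x - p x), norm_nonneg (y - p y)]
  let φ : Euc n → Euc n := fun x => x + a • u x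
  have hφ : ∀ x y, ‖x - y‖ ≤ ‖φ x - φ y‖ := by
    intro x y
    have e : φ x - φ y = (x - y) + a • (u x - u y) := by simp only [φ, smul_sub]; abel
    have : ‖x - y‖ ^ 2 ≤ ‖φ x - φ y‖ ^ 2 := by
      rw [e, norm_add_sq_real, real_inner_smul_right]
      have := mul_nonneg ha.le (mono x y)
      nlinarith [sq_nonneg ‖a • (u x - u y)‖]
    exact (abs_le_of_sq_le_sq' this (norm_nonneg _)).2
  have hshell : φ '' (Metric.cthickening b K \ K) ⊆
      Metric.cthickening (a + b) K \ Metric.cthickening a K := by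
    rintro _ ⟨x, ⟨hx1, hx2⟩, rfl⟩
    have hpos : 0 < ‖x - p x‖ := by
      rw [norm_pos_iff, sub_ne_zero]
      intro h; exact hx2 (h ▸ hp x)
    have hd := aux_infDist (hp x) (hpi x)
    rw [aux_mem_cth hne hb.le, hd] at hx1
    have e1 : φ x - p x = (‖x - p x‖ + a) • u x := by
      simp only [φ]; nth_rewrite 1 [hu x]; rw [add_smul]; abel
    have hd2 : Metric.infDist (φ x) K = ‖x - p x‖ + a := by
      rw [aux_infDist (hp x), e1, norm_smul, hu1 x hpos.ne', mul_one, Real.norm_of_nonneg]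
      · positivity
      · intro w hw
        rw [e1, real_inner_smul_left]
        exact mul_nonpos_of_nonneg_of_nonpos (by positivity) (hun x w hw)
    refine ⟨?_, ?_⟩
    · rw [aux_mem_cth hne (by positivity), hd2]; linarith
    · rw [aux_mem_cth hne ha.le, hd2]; linarith
  have hfin : ∀ e, volume (Metric.cthickening e K) ≠ ⊤ := fun e =>
    (hk.cthickening).measure_lt_top.ne
  have h1 := (aux_expand φ hφ (Metric.cthickening b K \ K)).trans (measure_mono hshell)
  rw [measure_sdiff (Metric.self_subset_cthickening K) hk.measurableSet.nullMeasurableSet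
    hk.measure_lt_top.ne, measure_sdiff (Metric.cthickening_mono (by linarith) K)
    (Metric.isClosed_cthickening.measurableSet.nullMeasurableSet) (hfin a)] at h1
  have h2 := ENNReal.toReal_mono (by exact ENNReal.sub_ne_top (hfin _)) h1
  rw [ENNReal.toReal_sub_of_le (measure_mono (Metric.self_subset_cthickening K)) (hfin _),
    ENNReal.toReal_sub_of_le (measure_mono (Metric.cthickening_mono (by linarith) K)) (hfin _)] at h2
  linarith

lemma aux_surface {K : Set (Euc n)} (hc : Convex ℝ K) (hk : IsCompact K) (hne : K.Nonempty)
    (c : ℝ) (h : ∀ e > 0, e * c ≤ (volume (Metric.cthickening e K)).toReal - (volume K).toReal) :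
    c ≤ surfaceArea K := by
  have hfin : ∀ e, volume (Metric.cthickening e K) ≠ ⊤ := fun e =>
    (hk.cthickening).measure_lt_top.ne
  obtain ⟨L, hL, ht⟩ := aux_limit
    (fun e => (volume (Metric.cthickening e K)).toReal - (volume K).toReal) c
    (fun e he => by rw [le_div_iff₀ he]; linarith [h e he])
    (fun e he => by
      have := ENNReal.toReal_mono (hfin e) (measure_mono (μ := volume) (Metric.self_subset_cthickening (δ := e) K))
      simpa using this)
    (fun a ha b hb => aux_super hc hk hne ha hb)
  rw [surfaceArea, ht.limUnder_eq]
  exact hL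

lemma aux_simplex (m : ℕ) : ENNReal.ofReal (1 / (m.factorial : ℝ)) ≤
    volume {x : Fin m → ℝ | (∀ i, 0 ≤ x i) ∧ ∑ i, x i ≤ 1} := by
  set S := {x : Fin m → ℝ | (∀ i, 0 ≤ x i) ∧ ∑ i, x i ≤ 1} with hS
  have h1 := MeasureTheory.volume_sum_rpow_lt_one (Fin m) (p := 1) le_rfl
  have hG : Real.Gamma (1 / 1 + 1) = 1 := by
    have := Real.Gamma_nat_eq_factorial 1
    norm_num at this ⊢
  have hG2 : Real.Gamma ((m : ℝ) / 1 + 1) = m.factorial := by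
    rw [div_one]; exact Real.Gamma_nat_eq_factorial m
  rw [hG, Fintype.card_fin, hG2] at h1
  simp only [Real.rpow_one, mul_one] at h1
  let sg : Bool → ℝ := fun c => if c then 1 else -1
  have hcov : {x : Fin m → ℝ | ∑ i, |x i| < 1} ⊆ ⋃ e : Fin m → Bool,
      (fun x : Fin m → ℝ => fun i => sg (e i) * x i) ⁻¹' S := by
    intro x hx
    simp only [mem_iUnion, mem_preimage, hS, mem_ofPred_eq]
    have : ∀ i, sg (decide (0 ≤ x i)) * x i = |x i| := by
      intro i
      by_cases h : 0 ≤ x i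
      · simp [sg, h, abs_of_nonneg h]
      · simp [sg, h, abs_of_neg (not_le.1 h)]
    refine ⟨fun i => decide (0 ≤ x i), fun i => ?_, ?_⟩
    · rw [this]; positivity
    · simp only [this]; exact le_of_lt hx
  have hmeas : MeasurableSet S := by
    apply IsClosed.measurableSet
    rw [hS, ofPred_and, ofPred_forall]
    refine IsClosed.inter (isClosed_iInter fun i => isClosed_le continuous_const (by fun_prop))
      (isClosed_le (by fun_prop) continuous_const)
  have hvol : ∀ e : Fin m → Bool,
      volume ((fun x : Fin m → ℝ => fun i => sg (e i) * x i) ⁻¹' S) = volume S := by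
    intro e
    have hmp : MeasurePreserving (fun x : Fin m → ℝ => fun i => sg (e i) * x i) := by
      apply volume_preserving_pi (f := fun i x => sg (e i) * x)
      intro i
      cases h : e i
      · simpa [sg] using Measure.measurePreserving_neg (volume : Measure ℝ)
      · simp only [sg, if_true, one_mul]; exact MeasurePreserving.id (volume : Measure ℝ)
    exact hmp.measure_preimage hmeas.nullMeasurableSet
  have h2 := (measure_mono (μ := volume) hcov).trans (measure_iUnion_le _)
  simp only [hvol, tsum_fintype, Finset.sum_const, Finset.card_univ, Fintype.card_fun,
    Fintype.card_bool, Fintype.card_fin, h1, nsmul_eq_mul] at h2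
  have e : ENNReal.ofReal (2 ^ m / (m.factorial : ℝ)) =
      ((2 ^ m : ℕ) : ℝ≥0∞) * ENNReal.ofReal (1 / m.factorial) := by
    rw [← ENNReal.ofReal_natCast, ← ENNReal.ofReal_mul (by positivity)]
    congr 1; push_cast; ring
  rw [e] at h2
  exact (ENNReal.mul_le_mul_iff_right (by simp) (by simp)).1 h2

lemma aux_det {m : ℕ} (w : Fin (m + 1) → Euc (m + 1)) (u v : Euc (m + 1)) (r : ℝ)
    (hu : ∀ i, ⟪u, w i⟫ = 1) (huv : ⟪u, v⟫ = r)
    (hdet : Matrix.det (Matrix.of fun i j => w j i) ≠ 0) :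
    Matrix.det (Matrix.of fun i j => (Fin.cons v (fun k : Fin m => w k.succ - w 0) :
      Fin (m + 1) → Euc (m + 1)) j i) = r * Matrix.det (Matrix.of fun i j => w j i) := by
  set W : Matrix (Fin (m+1)) (Fin (m+1)) ℝ := Matrix.of fun i j => w j i with hW
  set c : Fin (m + 1) → Euc (m + 1) := Fin.cons v (fun k : Fin m => w k.succ - w 0) with hcdef
  set M : Matrix (Fin (m+1)) (Fin (m+1)) ℝ := Matrix.of fun i j => c j i with hM
  have hinner : ∀ x y : Euc (m + 1), ⟪x, y⟫ = ∑ k, x k * y k := by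
    intro x y
    simp [PiLp.inner_apply, mul_comm]
  set R : Matrix (Fin (m+1)) (Fin (m+1)) ℝ :=
    Matrix.of (Fin.cons (fun k => u k) (fun i : Fin m => W⁻¹ i.succ)) with hR
  have hWW : W⁻¹ * W = 1 := Matrix.nonsing_inv_mul W (isUnit_iff_ne_zero.2 hdet)
  have R0 : ∀ (f : Fin (m+1) → Euc (m+1)) j, (R * Matrix.of fun i j => f j i) 0 j = ⟪u, f j⟫ := by
    intro f j
    rw [hinner, Matrix.mul_apply]
    simp [R]
  have RS : ∀ (f : Fin (m+1) → Euc (m+1)) (i : Fin m) j,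
      (R * Matrix.of fun i j => f j i) i.succ j = ∑ k, W⁻¹ i.succ k * f j k := by
    intro f i j
    rw [Matrix.mul_apply]
    simp [R]
  have hdual : ∀ i j, ∑ k, W⁻¹ i k * w j k = if i = j then 1 else 0 := by
    intro i j
    have := congrFun (congrFun hWW i) j
    rw [Matrix.mul_apply, Matrix.one_apply] at this
    simpa [W] using this
  have d1 : (R * W).det = 1 := by
    rw [Matrix.det_of_isUpperTriangular]
    · apply Finset.prod_eq_one
      intro i _
      refine Fin.cases ?_ (fun i => ?_) i
      · rw [hW, R0, hu]
      · rw [hW, RS, hdual]; simp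
    · intro i j hij
      simp only [id] at hij
      revert hij
      refine Fin.cases ?_ (fun i => ?_) i
      · intro h; exact absurd h (Fin.not_lt_zero _)
      · intro h
        rw [hW, RS, hdual, if_neg h.ne']
  have d2 : (R * M).det = r := by
    rw [Matrix.det_of_isLowerTriangular]
    · rw [Fin.prod_univ_succ, Finset.prod_eq_one, mul_one]
      · rw [hM, R0]; simp [c, huv]
      · intro i _
        rw [hM, RS]
        simp only [c, Fin.cons_succ, PiLp.sub_apply, mul_sub, Finset.sum_sub_distrib, hdual]
        simp
    · intro i j hij
      simp only [OrderDual.toDual_lt_toDual] at hij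
      revert hij
      refine Fin.cases ?_ (fun j => ?_) j
      · intro h; exact absurd h (Fin.not_lt_zero _)
      · refine Fin.cases ?_ (fun i => ?_) i
        · intro _; rw [hM, R0]; simp [c, inner_sub_right, hu]
        · intro h
          rw [hM, RS]
          simp only [c, Fin.cons_succ, PiLp.sub_apply, mul_sub, Finset.sum_sub_distrib, hdual]
          have : i.succ ≠ j.succ := h.ne
          simp [this]
  rw [Matrix.det_mul] at d1 d2
  have hR0 : R.det ≠ 0 := left_ne_zero_of_mul_eq_one d1
  apply mul_left_cancel₀ hR0
  rw [d2, mul_left_comm, d1, mul_one]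

lemma aux_box (m : ℕ) (h : ℝ) (hh : 0 < h) : ENNReal.ofReal (h / (m.factorial : ℝ)) ≤
    volume {y : Euc (m + 1) | (0 < y 0 ∧ y 0 ≤ h) ∧
      (∀ i : Fin m, 0 ≤ y i.succ) ∧ ∑ i : Fin m, y i.succ ≤ 1} := by
  set S := {x : Fin m → ℝ | (∀ i, 0 ≤ x i) ∧ ∑ i, x i ≤ 1} with hS
  have e1 : {y : Euc (m + 1) | (0 < y 0 ∧ y 0 ≤ h) ∧
      (∀ i : Fin m, 0 ≤ y i.succ) ∧ ∑ i : Fin m, y i.succ ≤ 1} =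
      (MeasurableEquiv.toLp 2 (Fin (m+1) → ℝ)).symm ⁻¹'
      ((MeasurableEquiv.piFinSuccAbove (fun _ : Fin (m+1) => ℝ) 0) ⁻¹' (Ioc 0 h ×ˢ S)) := by
    ext y
    simp [hS, MeasurableEquiv.piFinSuccAbove, Fin.tail, Fin.removeNth]
  rw [e1, (EuclideanSpace.volume_preserving_symm_measurableEquiv_toLp
    (Fin (m+1))).measure_preimage_equiv,
    (volume_preserving_piFinSuccAbove (fun _ : Fin (m+1) => ℝ) 0).measure_preimage_equiv,
    Measure.volume_eq_prod, Measure.prod_prod, Real.volume_Ioc, sub_zero, div_eq_mul_one_div,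
    ENNReal.ofReal_mul hh.le]
  gcongr
  exact aux_simplex m

lemma aux_trans (a : Euc n) (s : Set (Euc n)) : volume ((fun x => a + x) '' s) = volume s := by
  rw [Set.image_add_left, measure_preimage_add]

lemma aux_prism {m : ℕ} {K : Set (Euc (m + 1))} (hc : Convex ℝ K) (hk : IsCompact K)
    (w : Fin (m + 1) → Euc (m + 1)) (u : Euc (m + 1)) (hw : ∀ i, w i ∈ K)
    (hu : ∀ i, ⟪u, w i⟫ = 1) (hdet : Matrix.det (Matrix.of fun i j => w j i) ≠ 0) :
    ∃ C : Set (Euc (m + 1)), MeasurableSet C ∧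
      (∀ x ∈ C, ∃ p ∈ convexHull ℝ (Set.range w), ∃ t : ℝ, t > 0 ∧ x = p + t • (‖u‖⁻¹ • u)) ∧
      ∀ h > 0, ENNReal.ofReal (h * (‖u‖ * |Matrix.det (Matrix.of fun i j => w j i)| / m.factorial)) ≤
        volume ((Metric.cthickening h K \ K) ∩ C) := by
  have hu0 : u ≠ 0 := by rintro rfl; simpa using hu 0
  have hun : ‖u‖ ≠ 0 := norm_ne_zero_iff.2 hu0
  set v := ‖u‖⁻¹ • u with hv
  have hv1 : ‖v‖ = 1 := by simp [hv, norm_smul, hun]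
  have huv : ⟪u, v⟫ = ‖u‖ := by
    rw [hv, real_inner_smul_right, real_inner_self_eq_norm_sq]; field_simp
  set c : Fin (m + 1) → Euc (m + 1) := Fin.cons v (fun k : Fin m => w k.succ - w 0) with hcdef
  set M : Matrix (Fin (m+1)) (Fin (m+1)) ℝ := Matrix.of fun i j => c j i with hM
  have hMdet : M.det = ‖u‖ * Matrix.det (Matrix.of fun i j => w j i) :=
    aux_det w u v ‖u‖ hu huv hdet
  let L : Euc (m+1) →ₗ[ℝ] Euc (m+1) := Matrix.toLpLin 2 2 M
  have hLdet : LinearMap.det L = M.det := by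
    simp [L]
  have hLapp : ∀ y, L y = y 0 • v + ∑ i : Fin m, y i.succ • (w i.succ - w 0) := by
    intro y
    have : L y = ∑ j, y j • c j := by
      ext i
      simp [L, Matrix.toLpLin_apply, Matrix.mulVec, dotProduct, M, mul_comm]
    rw [this, Fin.sum_univ_succ]
    simp [c]
  have hLne : LinearMap.det L ≠ 0 := by
    rw [hLdet, hMdet]; exact mul_ne_zero hun hdet
  have hLinj : Function.Injective L := by
    rw [← LinearMap.ker_eq_bot]
    by_contra h
    exact hLne (LinearMap.det_eq_zero_iff_ker_ne_bot.2 h)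
  let A : Euc (m+1) → Euc (m+1) := fun y => w 0 + L y
  have hAinj : Function.Injective A := fun x y h => hLinj (add_left_cancel h)
  have hAcont : Continuous A := continuous_const.add L.continuous_of_finiteDimensional
  have hAemb : MeasurableEmbedding A := hAcont.measurableEmbedding hAinj
  let sx : Set (Euc (m+1)) := {y | (∀ i : Fin m, 0 ≤ y i.succ) ∧ ∑ i : Fin m, y i.succ ≤ 1}
  have hsx : MeasurableSet sx := by
    apply IsClosed.measurableSet
    simp only [sx, ofPred_and, ofPred_forall]
    refine IsClosed.inter (isClosed_iInter fun i => isClosed_le continuous_const (by fun_prop))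
      (isClosed_le (by fun_prop) continuous_const)
  have hpos : MeasurableSet {y : Euc (m+1) | 0 < y 0} :=
    (isOpen_lt continuous_const (by fun_prop)).measurableSet
  have hA : ∀ y ∈ sx, ∃ p ∈ convexHull ℝ (Set.range w), A y = p + y 0 • v := by
    intro y hy
    refine ⟨w 0 + ∑ i : Fin m, y i.succ • (w i.succ - w 0), ?_, ?_⟩
    · have e : w 0 + ∑ i : Fin m, y i.succ • (w i.succ - w 0) =
        ∑ i, (Fin.cons (1 - ∑ i : Fin m, y i.succ) (fun i : Fin m => y i.succ) :
          Fin (m+1) → ℝ) i • w i := by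
        rw [Fin.sum_univ_succ]
        simp only [Fin.cons_zero, Fin.cons_succ, smul_sub, Finset.sum_sub_distrib, sub_smul,
          one_smul, Finset.sum_smul]
        abel
      rw [e]
      apply (convex_convexHull ℝ (Set.range w)).sum_mem
      · intro i _
        refine Fin.cases ?_ (fun i => ?_) i
        · simpa using hy.2
        · simpa using hy.1 i
      · rw [Fin.sum_univ_succ]; simp
      · intro i _; exact subset_convexHull ℝ _ ⟨i, rfl⟩
    · simp only [A, hLapp]; abel
  have hhull : convexHull ℝ (Set.range w) ⊆ K := by
    apply convexHull_min _ hc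
    rintro _ ⟨i, rfl⟩; exact hw i
  set C := A '' ({y : Euc (m+1) | 0 < y 0} ∩ sx) with hC
  have hCm : MeasurableSet C := hAemb.measurableSet_image.2 (hpos.inter hsx)
  refine ⟨C, hCm, ?_, ?_⟩
  · rintro _ ⟨y, ⟨hy0, hys⟩, rfl⟩
    obtain ⟨p, hp, e⟩ := hA y hys
    exact ⟨p, hp, y 0, hy0, e⟩
  intro h hh
  set B : Set (Euc (m+1)) := {y : Euc (m + 1) | (0 < y 0 ∧ y 0 ≤ h) ∧
      (∀ i : Fin m, 0 ≤ y i.succ) ∧ ∑ i : Fin m, y i.succ ≤ 1} with hB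
  have hlay : ENNReal.ofReal (h * (‖u‖ * |Matrix.det (Matrix.of fun i j => w j i)| / m.factorial))
      ≤ volume (A '' B) := by
    have e : A '' B = (fun x => w 0 + x) '' (L '' B) := by
      rw [image_image]
    rw [e, aux_trans, Measure.addHaar_image_linearMap, hLdet, hMdet, abs_mul,
      abs_of_nonneg (norm_nonneg u)]
    have e2 : h * (‖u‖ * |Matrix.det (Matrix.of fun i j => w j i)| / m.factorial) =
      ‖u‖ * |Matrix.det (Matrix.of fun i j => w j i)| * (h / m.factorial) := by ring
    rw [e2, ENNReal.ofReal_mul (by positivity)]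
    gcongr
    exact aux_box m h hh
  have hKne : K.Nonempty := ⟨_, hw 0⟩
  have hcth : ∀ x ∈ K, ∀ t, 0 ≤ t → t ≤ h → x + t • v ∈ Metric.cthickening h K := by
    intro x hx t ht0 ht
    apply Metric.mem_cthickening_of_dist_le _ x _ _ hx
    rw [dist_eq_norm, add_sub_cancel_left, norm_smul, hv1, mul_one, Real.norm_of_nonneg ht0]
    exact ht
  set T := (fun x => h • v + x) '' (K ∩ C) with hT
  have hTm : volume T = volume (K ∩ C) := aux_trans _ _
  -- coordinate translation
  have hshift : ∀ y, A (y + EuclideanSpace.single 0 h) = h • v + A y := by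
    intro y
    simp only [A, map_add]
    have : L (EuclideanSpace.single 0 h) = h • v := by
      rw [hLapp]; simp
    rw [this]; abel
  have hTsub : T ⊆ Metric.cthickening h K ∩ C := by
    rintro _ ⟨_, ⟨hxK, ⟨y, ⟨hy0, hys⟩, rfl⟩⟩, rfl⟩
    refine ⟨?_, ?_⟩
    · simp only
      rw [add_comm (h • v)]; exact hcth _ hxK h hh.le le_rfl
    · refine ⟨y + EuclideanSpace.single 0 h, ⟨?_, ?_⟩, hshift y⟩
      · simp only [mem_ofPred_eq] at hy0 ⊢
        simp; linarith
      · simpa [sx] using hys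
  have hBsub : A '' B ⊆ Metric.cthickening h K ∩ C := by
    rintro _ ⟨y, hy, rfl⟩
    refine ⟨?_, ⟨y, ⟨hy.1.1, hy.2⟩, rfl⟩⟩
    obtain ⟨p, hp, e⟩ := hA y hy.2
    rw [e]
    exact hcth _ (hhull hp) _ hy.1.1.le hy.1.2
  have hdisj : Disjoint (A '' B) T := by
    rw [Set.disjoint_left]
    rintro _ ⟨y, hy, rfl⟩ ⟨_, ⟨hxK, ⟨y', ⟨hy0, hys⟩, rfl⟩⟩, e⟩
    simp only at e
    rw [← hshift] at e
    have := hAinj e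
    have h3 : y 0 = y' 0 + h := by rw [← this]; simp
    have h4 := hy.1.2
    simp only [mem_ofPred_eq] at hy0
    linarith
  have hTmeas : MeasurableSet T :=
    (MeasurableEquiv.addLeft (h • v)).measurableSet_image.2 (hk.measurableSet.inter hCm)
  have hfin : volume (K ∩ C) ≠ ⊤ := ((measure_mono inter_subset_left).trans_lt hk.measure_lt_top).ne
  have key : volume (A '' B) + volume (K ∩ C) ≤
      volume ((Metric.cthickening h K \ K) ∩ C) + volume (K ∩ C) := by
    rw [← hTm, ← measure_union hdisj hTmeas, hTm]
    refine (measure_mono (union_subset hBsub hTsub)).trans ?_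
    refine le_trans (measure_mono ?_) (measure_union_le _ _)
    rintro x ⟨h1, h2⟩
    by_cases hx : x ∈ K
    · exact Or.inr ⟨hx, h2⟩
    · exact Or.inl ⟨⟨h1, hx⟩, h2⟩
  exact hlay.trans ((ENNReal.add_le_add_iff_right hfin).1 key)

def sg (c : Bool) : ℝ := if c then 1 else -1

lemma sg_sq (c : Bool) : sg c * sg c = 1 := by cases c <;> simp [sg]

lemma sg_abs (c : Bool) : |sg c| = 1 := by cases c <;> simp [sg]

lemma aux_layers {m : ℕ} {K : Set (Euc (m + 1))} (hc : Convex ℝ K) (hk : IsCompact K)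
    (hsym : K = -K) (w d : Fin (m + 1) → Euc (m + 1)) (hw : ∀ i, w i ∈ K)
    (hd : ∀ i j, ⟪d i, w j⟫ = if i = j then 1 else 0)
    (hdet : Matrix.det (Matrix.of fun i j => w j i) ≠ 0) (h : ℝ) (hh : 0 < h) :
    h * ∑ e : Fin (m + 1) → Bool, (‖∑ i, sg (e i) • d i‖ *
      |Matrix.det (Matrix.of fun i j => w j i)| / m.factorial) ≤
    (volume (Metric.cthickening h K)).toReal - (volume K).toReal := by
  let w' : (Fin (m + 1) → Bool) → Fin (m + 1) → Euc (m + 1) := fun e i => sg (e i) • w i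
  let u : (Fin (m + 1) → Bool) → Euc (m + 1) := fun e => ∑ i, sg (e i) • d i
  have hdw : ∀ e, |Matrix.det (Matrix.of fun i j => w' e j i)| =
      |Matrix.det (Matrix.of fun i j => w j i)| := by
    intro e
    have := Matrix.det_mul_row (fun j => sg (e j)) (Matrix.of fun i j => w j i)
    have e2 : (Matrix.of fun i j => w' e j i) =
      Matrix.of fun i j => sg (e j) * (Matrix.of (fun i j => w j i) : Matrix _ _ ℝ) i j := by
      ext i j; simp [w']
    rw [e2, this, abs_mul, Finset.abs_prod]
    simp [sg_abs]
  have hw' : ∀ e i, w' e i ∈ K := by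
    intro e i
    simp only [w', sg]
    split_ifs
    · simpa using hw i
    · rw [hsym]; simpa using hw i
  have huw0 : ∀ e j, ⟪u e, w j⟫ = sg (e j) := by
    intro e j
    simp [u, sum_inner, real_inner_smul_left, hd]
  have huw : ∀ e e' j, ⟪u e, w' e' j⟫ = sg (e' j) * sg (e j) := by
    intro e e' j
    simp only [w', real_inner_smul_right, huw0]
  have hu1 : ∀ e i, ⟪u e, w' e i⟫ = 1 := fun e i => by rw [huw, sg_sq]
  have hule : ∀ e e' i, ⟪u e, w' e' i⟫ ≤ 1 := fun e e' i => by
    rw [huw]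
    cases e i <;> cases e' i <;> simp [sg] <;> norm_num
  have hdet' : ∀ e, Matrix.det (Matrix.of fun i j => w' e j i) ≠ 0 := fun e => by
    rw [← abs_pos, hdw, abs_pos]; exact hdet
  choose C hCm hCp hCv using fun e => aux_prism hc hk (w' e) (u e) (hw' e) (hu1 e) (hdet' e)
  have hu0 : ∀ e, u e ≠ 0 := fun e he => by have := hu1 e 0; rw [he] at this; simp at this
  have hhull : ∀ e e', ∀ p ∈ convexHull ℝ (Set.range (w' e')), ⟪u e, p⟫ ≤ 1 := by
    intro e e' p hp
    have : convexHull ℝ (Set.range (w' e')) ⊆ {x | ⟪u e, x⟫ ≤ 1} := by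
      apply convexHull_min
      · rintro _ ⟨i, rfl⟩; exact hule e e' i
      · exact convex_halfSpace_le (innerₗ (Euc (m+1)) (u e)).isLinear 1
    exact this hp
  have hhull' : ∀ e, ∀ p ∈ convexHull ℝ (Set.range (w' e)), ⟪u e, p⟫ = 1 := by
    intro e p hp
    have : convexHull ℝ (Set.range (w' e)) ⊆ {x | ⟪u e, x⟫ = 1} := by
      apply convexHull_min
      · rintro _ ⟨i, rfl⟩; exact hu1 e i
      · exact convex_hyperplane (innerₗ (Euc (m+1)) (u e)).isLinear 1
    exact this hp
  have hdisj : Pairwise fun e e' => Disjoint (C e) (C e') := by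
    intro e e' hne
    rw [Set.disjoint_left]
    intro x hx hx'
    obtain ⟨p, hp, t, ht, e1⟩ := hCp e x hx
    obtain ⟨p', hp', t', ht', e2⟩ := hCp e' x hx'
    have hn : ∀ e, 0 < ‖u e‖ := fun e => norm_pos_iff.2 (hu0 e)
    set a := ‖u e‖⁻¹ • u e with ha
    set a' := ‖u e'‖⁻¹ • u e' with ha'
    have na : ‖a‖ = 1 := by simp [ha, norm_smul, (hn e).ne']
    have na' : ‖a'‖ = 1 := by simp [ha', norm_smul, (hn e').ne']
    have hlt : ⟪a, a'⟫ < 1 := by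
      rw [inner_lt_one_iff_real_of_norm_eq_one na na']
      intro haa
      apply hne
      funext j
      have : ⟪a, w j⟫ = ⟪a', w j⟫ := by rw [haa]
      simp only [ha, ha', real_inner_smul_left, huw0] at this
      have q1 := inv_pos.2 (hn e)
      have q2 := inv_pos.2 (hn e')
      cases h1 : e j <;> cases h2 : e' j <;> simp [sg, h1, h2] at this ⊢ <;> linarith
    have g1 : 0 ≤ ⟪a, p - p'⟫ := by
      rw [ha, real_inner_smul_left, inner_sub_right]
      have := hhull e e' p' hp'
      have := hhull' e p hp
      exact mul_nonneg (inv_pos.2 (hn e)).le (by linarith)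
    have g2 : 0 ≤ ⟪a', p' - p⟫ := by
      rw [ha', real_inner_smul_left, inner_sub_right]
      have := hhull e' e p hp
      have := hhull' e' p' hp'
      exact mul_nonneg (inv_pos.2 (hn e')).le (by linarith)
    clear_value a a'
    have e3 : p - p' = t' • a' - t • a := by
      have : p + t • a = p' + t' • a' := e1.symm.trans e2
      rw [sub_eq_sub_iff_add_eq_add, this]; abel
    have e4 : p' - p = t • a - t' • a' := by rw [← neg_sub, e3, neg_sub]
    rw [e3, inner_sub_right, real_inner_smul_right, real_inner_smul_right,
      real_inner_self_eq_norm_sq, na] at g1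
    rw [e4, inner_sub_right, real_inner_smul_right, real_inner_smul_right,
      real_inner_self_eq_norm_sq, na', real_inner_comm] at g2
    nlinarith
  have hfin : ∀ e, volume (Metric.cthickening e K) ≠ ⊤ := fun e =>
    (hk.cthickening).measure_lt_top.ne
  have h1 : ∑ e : Fin (m + 1) → Bool, ENNReal.ofReal (h * (‖u e‖ *
      |Matrix.det (Matrix.of fun i j => w j i)| / m.factorial)) ≤
      volume (Metric.cthickening h K \ K) := by
    calc _ ≤ ∑ e, volume ((Metric.cthickening h K \ K) ∩ C e) := by
          apply Finset.sum_le_sum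
          intro e _
          have := hCv e h hh
          rwa [hdw] at this
      _ = volume (⋃ e, ((Metric.cthickening h K \ K) ∩ C e)) := by
          rw [measure_iUnion, tsum_fintype]
          · intro e e' hne
            exact (hdisj hne).mono inter_subset_right inter_subset_right
          · intro e
            exact (Metric.isClosed_cthickening.measurableSet.diff hk.measurableSet).inter (hCm e)
      _ ≤ _ := measure_mono (iUnion_subset fun e => inter_subset_left)
  rw [measure_sdiff (Metric.self_subset_cthickening K) hk.measurableSet.nullMeasurableSet
    hk.measure_lt_top.ne, ← ENNReal.ofReal_sum_of_nonneg (fun e _ => by positivity),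
    ENNReal.ofReal_le_iff_le_toReal (ENNReal.sub_ne_top (hfin _)),
    ENNReal.toReal_sub_of_le (measure_mono (Metric.self_subset_cthickening K)) (hfin _),
    ← Finset.mul_sum] at h1
  exact h1

lemma aux_gs {k : ℕ} (c : Fin k → Euc n) (hc : LinearIndependent ℝ c) :
    ∃ z : Fin k → Euc n, Orthonormal ℝ z ∧ (∀ i, c i = ∑ l, ⟪z l, c i⟫ • z l) ∧
      ∀ i l, i < l → ⟪z l, c i⟫ = 0 := by
  refine ⟨InnerProductSpace.gramSchmidtNormed ℝ c, InnerProductSpace.gramSchmidtNormed_orthonormal hc, ?_, ?_⟩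
  · intro i
    have h1 : c i ∈ Submodule.span ℝ (Set.range (InnerProductSpace.gramSchmidtNormed ℝ c)) := by
      rw [InnerProductSpace.span_gramSchmidtNormed_range, InnerProductSpace.span_gramSchmidt]
      exact Submodule.subset_span ⟨i, rfl⟩
    obtain ⟨a, ha⟩ := (Submodule.mem_span_range_iff_exists_fun ℝ).1 h1
    have : ∀ l, ⟪InnerProductSpace.gramSchmidtNormed ℝ c l, c i⟫ = a l := by
      intro l
      rw [← ha]
      exact (InnerProductSpace.gramSchmidtNormed_orthonormal hc).inner_right_fintype a l
    simp only [this]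
    exact ha.symm
  · intro i l hil
    rw [InnerProductSpace.gramSchmidtNormed, real_inner_smul_left]
    rw [InnerProductSpace.gramSchmidt_inv_triangular ℝ c hil, mul_zero]

lemma aux_inner_expand {k : ℕ} (z : Fin k → Euc n) (x y : Euc n)
    (hx : x = ∑ l, ⟪z l, x⟫ • z l) : ⟪x, y⟫ = ∑ l, ⟪z l, x⟫ * ⟪z l, y⟫ := by
  nth_rewrite 1 [hx]
  simp [sum_inner, real_inner_smul_left]

lemma aux_gram {k : ℕ} (z c : Fin k → Euc n) (hx : ∀ i, c i = ∑ l, ⟪z l, c i⟫ • z l) :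
    Matrix.det (Matrix.of fun i j => ⟪c i, c j⟫) =
      (Matrix.det (Matrix.of fun i l => ⟪z l, c i⟫)) ^ 2 := by
  have : (Matrix.of fun i j => ⟪c i, c j⟫) =
      (Matrix.of fun i l => ⟪z l, c i⟫) * (Matrix.of fun i l => ⟪z l, c i⟫).transpose := by
    ext i j
    rw [Matrix.mul_apply]
    simpa using aux_inner_expand z (c i) (c j) (hx i)
  rw [this, Matrix.det_mul, Matrix.det_transpose, sq]

lemma aux_abel (m : ℕ) : ∀ (a l : Fin (m + 1) → ℝ), Antitone a →
    (∀ k (hk : k + 1 ≤ m + 1), 0 ≤ ∑ i : Fin (k + 1), l (Fin.castLE hk i)) →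
    a (Fin.last m) * ∑ i, l i ≤ ∑ i, a i * l i := by
  induction m with
  | zero => intro a l _ _; simp
  | succ m ih =>
    intro a l ha hl
    have h1 := ih (a ∘ Fin.castSucc) (l ∘ Fin.castSucc)
      (fun i j hij => ha (by simpa using hij)) (fun k hk => hl k (by omega))
    have h2 : 0 ≤ ∑ i : Fin (m + 1), l (Fin.castSucc i) := hl m (by omega)
    rw [Fin.sum_univ_castSucc l, Fin.sum_univ_castSucc (fun i => a i * l i)]
    simp only [Function.comp] at h1
    have h3 : a (Fin.last (m + 1)) ≤ a (Fin.castSucc (Fin.last m)) := ha (Fin.le_last _)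
    nlinarith

lemma aux_weight (m : ℕ) (a r : Fin (m + 1) → ℝ) (D : ℝ) (hD : 0 < D) (ha : Antitone a)
    (ha0 : ∀ i, 0 ≤ a i) (hr : ∀ i, 0 < r i)
    (hp : ∀ k (hk : k + 1 ≤ m + 1), D ^ (k + 1) ≤ ∏ i : Fin (k + 1), r (Fin.castLE hk i)) :
    D * ∑ i, a i ≤ ∑ i, a i * r i := by
  have hpart : ∀ k (hk : k + 1 ≤ m + 1),
      0 ≤ ∑ i : Fin (k + 1), Real.log (r (Fin.castLE hk i) / D) := by
    intro k hk
    rw [← Real.log_prod (fun i _ => (div_pos (hr _) hD).ne')]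
    apply Real.log_nonneg
    rw [Finset.prod_div_distrib, le_div_iff₀ (by positivity)]
    simpa using hp k hk
  have h1 := aux_abel m a (fun i => Real.log (r i / D)) ha hpart
  have h2 : 0 ≤ ∑ i, a i * Real.log (r i / D) := by
    refine le_trans (mul_nonneg (ha0 _) ?_) h1
    exact hpart m le_rfl
  have h3 : ∑ i, a i * (1 + Real.log (r i / D)) ≤ ∑ i, a i * (r i / D) := by
    apply Finset.sum_le_sum
    intro i _
    apply mul_le_mul_of_nonneg_left _ (ha0 i)
    linarith [Real.log_le_sub_one_of_pos (div_pos (hr i) hD)]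
  simp only [mul_add, mul_one, Finset.sum_add_distrib] at h3
  have h4 : ∑ i, a i * r i = D * ∑ i, a i * (r i / D) := by
    rw [Finset.mul_sum]; apply Finset.sum_congr rfl; intro i _; field_simp
  rw [h4]
  apply mul_le_mul_of_nonneg_left _ hD.le
  linarith

lemma aux_sg_sum {N : ℕ} (i j : Fin N) :
    ∑ e : Fin N → Bool, sg (e i) * sg (e j) = if i = j then (2 : ℝ) ^ N else 0 := by
  split_ifs with h
  · subst h; simp [sg_sq]
  · apply Finset.sum_involution (fun e _ => Function.update e i (!(e i)))
    · intro e _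
      rw [Function.update_self, Function.update_of_ne (Ne.symm h)]
      cases e i <;> cases e j <;> simp [sg]
    · intro e _ _ he
      have := congrFun he i
      simp at this
    · intros; simp
    · intro e _; simp

lemma aux_Dmin_le (Λ : Set (Euc n)) (k : ℕ) (hk : k + 1 ≤ n) (c : Fin (k + 1) → Euc n)
    (hc : LinearIndependent ℝ c) (hm : ∀ j, c j ∈ Λ) (h0 : 0 ≤ Dmin Λ) :
    (Dmin Λ) ^ (k + 1) ≤ Real.sqrt (Matrix.det (Matrix.of fun i j => ⟪c i, c j⟫)) := by
  have h1 : minSublatticeDet Λ (k + 1) ≤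
      Real.sqrt (Matrix.det (Matrix.of fun i j => ⟪c i, c j⟫)) := by
    apply csInf_le
    · exact ⟨0, by rintro _ ⟨c, _, _, rfl⟩; positivity⟩
    · exact ⟨c, hc, hm, rfl⟩
  have h00 : ∀ i, 0 ≤ minSublatticeDet Λ i := by
    intro i
    apply Real.sInf_nonneg
    rintro _ ⟨c, _, _, rfl⟩; positivity
  have h2 : Dmin Λ ≤ minSublatticeDet Λ (k + 1) ^ ((1 : ℝ) / ((k : ℕ) + 1)) := by
    apply csInf_le
    · refine ⟨0, ?_⟩
      rintro _ ⟨i, rfl⟩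
      exact Real.rpow_nonneg (h00 _) _
    · exact ⟨⟨k, hk⟩, rfl⟩
  refine le_trans (pow_le_pow_left₀ h0 h2 (k + 1)) (le_trans (le_of_eq ?_) h1)
  rw [← Real.rpow_natCast, ← Real.rpow_mul (h00 _)]
  have : (1 : ℝ) / ((k : ℕ) + 1) * ((k + 1 : ℕ) : ℝ) = 1 := by push_cast; field_simp
  rw [this, Real.rpow_one]

lemma aux_signs_anti {m : ℕ} (Λ : Set (Euc (m + 1))) (x : Fin (m + 1) → Euc (m + 1))
    (hx : LinearIndependent ℝ x) (hm : ∀ i, x i ∈ Λ) (t : Fin (m + 1) → ℝ)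
    (ht : ∀ i, 0 < t i) (hanti : Antitone t) (hD : 0 < Dmin Λ) :
    2 ^ (m + 1) * (Dmin Λ * Real.sqrt (∑ i, t i ^ 2)) ≤
      ∑ e : Fin (m + 1) → Bool, ‖∑ i, sg (e i) • t i • x i‖ := by
  obtain ⟨z, hz, hexp, htri⟩ := aux_gs x hx
  set r : Fin (m + 1) → ℝ := fun i => ⟪z i, x i⟫ with hr
  have hprod : ∀ k (hk : k + 1 ≤ m + 1),
      Dmin Λ ^ (k + 1) ≤ ∏ i : Fin (k + 1), |r (Fin.castLE hk i)| := by
    intro k hk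
    have h1 := aux_Dmin_le Λ k hk (x ∘ Fin.castLE hk)
      (hx.comp _ (Fin.castLE_injective hk)) (fun j => hm _) hD.le
    have h2 := aux_gram (z ∘ Fin.castLE hk) (x ∘ Fin.castLE hk) (by
      intro i
      refine (hexp (Fin.castLE hk i)).trans (Eq.symm ?_)
      apply Finset.sum_of_injOn (Fin.castLE hk) (Fin.castLE_injective hk).injOn
      · intro _ _; simp
      · intro l _ hl
        have : Fin.castLE hk i < l := by
          by_contra hcon
          push Not at hcon
          apply hl
          have hlt : (l : ℕ) < k + 1 := lt_of_le_of_lt (Fin.le_def.1 hcon) i.2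
          exact ⟨⟨l, hlt⟩, by simp, rfl⟩
        rw [htri _ _ this, zero_smul]
      · intro _ _; rfl)
    have hdetR : Matrix.det (Matrix.of fun i l : Fin (k + 1) =>
        ⟪(z ∘ Fin.castLE hk) l, (x ∘ Fin.castLE hk) i⟫) = ∏ i, r (Fin.castLE hk i) := by
      rw [Matrix.det_of_isLowerTriangular]
      · rfl
      · intro i j hij
        simp only [OrderDual.toDual_lt_toDual] at hij
        exact htri _ _ (by simpa using hij)
    rw [hdetR] at h2
    rw [h2, Real.sqrt_sq_eq_abs, Finset.abs_prod] at h1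
    exact h1
  have hrpos : ∀ i, 0 < |r i| := by
    intro i
    have h1 := hprod m le_rfl
    have h2 : 0 < ∏ i : Fin (m + 1), |r i| := lt_of_lt_of_le (by positivity) h1
    rw [abs_pos]
    intro h0
    have : ∏ i : Fin (m + 1), |r i| = 0 := Finset.prod_eq_zero (Finset.mem_univ i) (by simp [h0])
    linarith
  have hw := aux_weight m (fun i => t i ^ 2) (fun i => |r i|) (Dmin Λ) hD
    (fun i j hij => pow_le_pow_left₀ (ht j).le (hanti hij) 2) (fun i => by positivity) hrpos hprod
  set s := Real.sqrt (∑ i, t i ^ 2) with hs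
  have hsum : 0 < ∑ i, t i ^ 2 := Finset.sum_pos (fun i _ => pow_pos (ht i) 2) ⟨0, by simp⟩
  have hspos : 0 < s := Real.sqrt_pos.2 hsum
  have hssq : s ^ 2 = ∑ i, t i ^ 2 := Real.sq_sqrt hsum.le
  let y : (Fin (m + 1) → Bool) → Euc (m + 1) := fun e =>
    ∑ j, (sg (e j) * t j * SignType.sign (r j)) • z j
  have hsgn : ∀ j, ((SignType.sign (r j) : SignType) : ℝ) ^ 2 = 1 := by
    intro j
    have : r j ≠ 0 := abs_pos.1 (hrpos j)
    rcases lt_or_gt_of_ne this with h | h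
    · simp [sign_neg h]
    · simp [sign_pos h]
  have hy : ∀ e, ‖y e‖ = s := by
    intro e
    have : ‖y e‖ ^ 2 = s ^ 2 := by
      rw [hssq, ← real_inner_self_eq_norm_sq, hz.inner_sum]
      apply Finset.sum_congr rfl
      intro j _
      have h1 := sg_sq (e j)
      have h2 := hsgn j
      simp only [conj_trivial]
      calc _ = (sg (e j) * sg (e j)) * t j ^ 2 * ((SignType.sign (r j) : SignType) : ℝ) ^ 2 := by ring
        _ = _ := by rw [h1, h2]; ring
    exact (sq_eq_sq₀ (norm_nonneg _) hspos.le).1 this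
  have hcs : ∀ e, ⟪∑ i, sg (e i) • t i • x i, y e⟫ ≤ ‖∑ i, sg (e i) • t i • x i‖ * s := by
    intro e
    rw [← hy e]; exact real_inner_le_norm _ _
  have hsumin : ∑ e, ⟪∑ i, sg (e i) • t i • x i, y e⟫ = 2 ^ (m + 1) * ∑ i, t i ^ 2 * |r i| := by
    have e1 : ∀ e, ⟪∑ i, sg (e i) • t i • x i, y e⟫ =
        ∑ i, ∑ j, (sg (e i) * sg (e j)) * (t i * t j * SignType.sign (r j) * ⟪x i, z j⟫) := by
      intro e
      simp only [y, sum_inner, inner_sum, real_inner_smul_left, real_inner_smul_right]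
      rw [Finset.sum_comm]
      apply Finset.sum_congr rfl; intro i _
      apply Finset.sum_congr rfl; intro j _
      ring
    simp only [e1]
    rw [Finset.sum_comm, Finset.mul_sum]
    apply Finset.sum_congr rfl
    intro i _
    rw [Finset.sum_comm]
    simp only [← Finset.sum_mul, aux_sg_sum]
    simp only [ite_mul, zero_mul, Finset.sum_ite_eq, Finset.mem_univ, if_true]
    rw [real_inner_comm]
    have : ((SignType.sign (r i) : SignType) : ℝ) * r i = |r i| := sign_mul_self (r i)
    rw [← this]; simp only [hr]; ring
  have hfinal : 2 ^ (m + 1) * (Dmin Λ * s ^ 2) ≤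
      (∑ e : Fin (m + 1) → Bool, ‖∑ i, sg (e i) • t i • x i‖) * s := by
    rw [Finset.sum_mul, hssq]
    refine le_trans ?_ (Finset.sum_le_sum fun e _ => hcs e)
    rw [hsumin]
    gcongr
  have : (2 ^ (m + 1) * (Dmin Λ * s)) * s ≤
      (∑ e : Fin (m + 1) → Bool, ‖∑ i, sg (e i) • t i • x i‖) * s := by
    refine le_trans (le_of_eq ?_) hfinal; ring
  exact le_of_mul_le_mul_right this hspos

lemma aux_signs {m : ℕ} (Λ : Set (Euc (m + 1))) (x : Fin (m + 1) → Euc (m + 1))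
    (hx : LinearIndependent ℝ x) (hm : ∀ i, x i ∈ Λ) (t : Fin (m + 1) → ℝ)
    (ht : ∀ i, 0 < t i) (hmono : Monotone t) (hD : 0 < Dmin Λ) :
    2 ^ (m + 1) * (Dmin Λ * Real.sqrt (∑ i, t i ^ 2)) ≤
      ∑ e : Fin (m + 1) → Bool, ‖∑ i, sg (e i) • t i • x i‖ := by
  have h := aux_signs_anti Λ (x ∘ Fin.rev) (hx.comp _ Fin.rev_injective) (fun i => hm _)
    (t ∘ Fin.rev) (fun i => ht _) (fun i j hij => hmono (Fin.rev_le_rev.2 hij)) hD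
  have e1 : ∑ i, (t ∘ Fin.rev) i ^ 2 = ∑ i, t i ^ 2 :=
    Equiv.sum_comp Fin.revPerm (fun i => t i ^ 2)
  have e2 : ∑ e : Fin (m + 1) → Bool, ‖∑ i, sg (e i) • (t ∘ Fin.rev) i • (x ∘ Fin.rev) i‖ =
      ∑ e : Fin (m + 1) → Bool, ‖∑ i, sg (e i) • t i • x i‖ := by
    rw [← Equiv.sum_comp (Equiv.arrowCongr Fin.revPerm (Equiv.refl Bool))]
    apply Finset.sum_congr rfl
    intro e _
    congr 1
    rw [← Equiv.sum_comp Fin.revPerm]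
    apply Finset.sum_congr rfl
    intro i _
    simp
  rw [e1, e2] at h
  exact h

lemma aux_detne (b : Fin n → Euc n) (hb : LinearIndependent ℝ b) :
    Matrix.det (Matrix.of fun i j => b j i) ≠ 0 := by
  have h1 : LinearIndependent ℝ (Matrix.of fun i j => b j i : Matrix (Fin n) (Fin n) ℝ).col :=
    hb.map' (WithLp.linearEquiv 2 ℝ (Fin n → ℝ)).toLinearMap (LinearEquiv.ker _)
  rw [Matrix.linearIndependent_cols_iff_isUnit, Matrix.isUnit_iff_isUnit_det] at h1
  exact h1.ne_zero

lemma aux_dual (b : Fin n → Euc n) (hb : LinearIndependent ℝ b) :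
    ∃ d : Fin n → Euc n, ∀ i j, ⟪d i, b j⟫ = if i = j then (1 : ℝ) else 0 := by
  have h := aux_detne b hb
  refine ⟨fun i => WithLp.toLp 2 ((Matrix.of fun i j => b j i : Matrix (Fin n) (Fin n) ℝ)⁻¹ i), ?_⟩
  intro i j
  have h1 := Matrix.nonsing_inv_mul (Matrix.of fun i j => b j i : Matrix (Fin n) (Fin n) ℝ)
    (isUnit_iff_ne_zero.2 h)
  have h2 := congrFun (congrFun h1 i) j
  rw [Matrix.mul_apply, Matrix.one_apply] at h2
  rw [← h2, PiLp.inner_apply]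
  apply Finset.sum_congr rfl
  intro k _
  simp [mul_comm]

lemma aux_dual_li {k : ℕ} (b d : Fin k → Euc n)
    (h : ∀ i j, ⟪d i, b j⟫ = if i = j then (1 : ℝ) else 0) : LinearIndependent ℝ d := by
  rw [Fintype.linearIndependent_iff]
  intro g hg j
  have : ⟪∑ i, g i • d i, b j⟫ = g j := by
    simp [sum_inner, real_inner_smul_left, h]
  rw [← this, hg, inner_zero_left]

lemma aux_span (b : Fin n → Euc n) (hb : LinearIndependent ℝ b) (x : Euc n)
    (hx : ∀ j, ⟪x, b j⟫ = 0) : x = 0 := by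
  have h1 : Submodule.span ℝ (Set.range b) = ⊤ :=
    hb.span_eq_top_of_card_eq_finrank' (by simp)
  have h2 : x ∈ Submodule.span ℝ (Set.range b) := by rw [h1]; trivial
  obtain ⟨a, ha⟩ := (Submodule.mem_span_range_iff_exists_fun ℝ).1 h2
  have : ⟪x, x⟫ = 0 := by
    nth_rewrite 2 [← ha]
    simp [inner_sum, real_inner_smul_right, hx]
  exact inner_self_eq_zero.1 this

lemma aux_mem_latticeOf (b : Fin n → Euc n) (j : Fin n) : b j ∈ latticeOf b :=
  ⟨fun i => if i = j then 1 else 0, by simp⟩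

lemma aux_mem_polar (b : Fin n → Euc n) (x : Euc n) (h : ∀ j, ∃ m : ℤ, ⟪x, b j⟫ = (m : ℝ)) :
    x ∈ polarLattice (latticeOf b) := by
  choose m hm using h
  rintro y ⟨z, rfl⟩
  refine ⟨∑ i, z i * m i, ?_⟩
  simp [inner_sum, real_inner_smul_right, hm]

lemma aux_lower (b : Fin n → Euc n) (hb : LinearIndependent ℝ b) (k : ℕ) :
    ∃ κ : ℝ, 0 < κ ∧ ∀ c : Fin k → Euc n, LinearIndependent ℝ c →
      (∀ j, c j ∈ polarLattice (latticeOf b)) →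
      κ ≤ Real.sqrt (Matrix.det (Matrix.of fun i j => ⟪c i, c j⟫)) := by
  set X : ℝ := ∑ j, ‖b j‖ ^ 2 + 1 with hX
  have hX0 : 0 < X := by positivity
  set C : ℝ := (k.factorial : ℝ) * X ^ k with hC
  have hC0 : 0 < C := by positivity
  refine ⟨Real.sqrt (1 / C), by positivity, ?_⟩
  intro c hc hm
  apply Real.sqrt_le_sqrt
  obtain ⟨z, hz, hexp, -⟩ := aux_gs c hc
  rw [aux_gram z c hexp]
  set R : Matrix (Fin k) (Fin k) ℝ := Matrix.of fun i l => ⟪z l, c i⟫ with hR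
  let Y : Matrix (Fin k) (Fin n) ℝ := Matrix.of fun l j => ⟪z l, b j⟫
  choose N hN using fun i j => hm i (b j) (aux_mem_latticeOf b j)
  let NZ : Matrix (Fin k) (Fin n) ℤ := Matrix.of N
  let NR : Matrix (Fin k) (Fin n) ℝ := Matrix.of fun i j => ⟪c i, b j⟫
  have hNR : NR = NZ.map (Int.castRingHom ℝ) := by
    ext i j; simp [NR, NZ, hN]
  have hRY : NR = R * Y := by
    ext i j
    rw [Matrix.mul_apply]
    exact aux_inner_expand z (c i) (b j) (hexp i)
  have hdet1 : Matrix.det (NR * NR.transpose) = R.det ^ 2 * Matrix.det (Y * Y.transpose) := by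
    rw [hRY, Matrix.transpose_mul]
    rw [show R * Y * (Y.transpose * R.transpose) = R * (Y * Y.transpose) * R.transpose by
      simp only [Matrix.mul_assoc]]
    rw [Matrix.det_mul, Matrix.det_mul, Matrix.det_transpose]; ring
  have hdet2 : Matrix.det (NR * NR.transpose) = ((Matrix.det (NZ * NZ.transpose) : ℤ) : ℝ) := by
    have := RingHom.map_det (Int.castRingHom ℝ) (NZ * NZ.transpose)
    rw [eq_intCast] at this
    rw [this, RingHom.mapMatrix_apply, Matrix.map_mul, Matrix.transpose_map, ← hNR]
  have hne : Matrix.det (NR * NR.transpose) ≠ 0 := by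
    intro h0
    obtain ⟨v, hv0, hv⟩ := Matrix.exists_vecMul_eq_zero_iff.2 h0
    apply hv0
    have h1 : Matrix.vecMul v NR = 0 := by
      have : Matrix.vecMul v NR ⬝ᵥ Matrix.vecMul v NR = 0 := by
        rw [← Matrix.vecMul_vecMul] at hv
        have h2 : Matrix.vecMul (Matrix.vecMul v NR) NR.transpose ⬝ᵥ v = 0 := by rw [hv]; simp
        rw [← Matrix.dotProduct_mulVec, Matrix.mulVec_transpose] at h2
        exact h2
      exact dotProduct_self_eq_zero.1 this
    have h2 : ∑ i, v i • c i = 0 := by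
      apply aux_span b hb
      intro j
      have h3 := congrFun h1 j
      simp only [Matrix.vecMul, dotProduct, NR, Matrix.of_apply] at h3
      simpa [sum_inner, real_inner_smul_left] using h3
    funext i
    exact Fintype.linearIndependent_iff.1 hc v h2 i
  have hone : 1 ≤ |Matrix.det (NR * NR.transpose)| := by
    rw [hdet2] at hne ⊢
    have : Matrix.det (NZ * NZ.transpose) ≠ 0 := by exact_mod_cast hne
    exact_mod_cast Int.one_le_abs this
  have hYb : |Matrix.det (Y * Y.transpose)| ≤ C := by
    have hent : ∀ i j, |(Y * Y.transpose) i j| ≤ X := by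
      intro i j
      rw [Matrix.mul_apply]
      refine (Finset.abs_sum_le_sum_abs _ _).trans ?_
      have : ∑ l, |Y i l * Y.transpose l j| ≤ ∑ l, ‖b l‖ ^ 2 := by
        apply Finset.sum_le_sum
        intro l _
        rw [abs_mul, sq]
        have hb1 : ∀ i, |⟪z i, b l⟫| ≤ ‖b l‖ := by
          intro i
          have := abs_real_inner_le_norm (z i) (b l)
          rwa [hz.1 i, one_mul] at this
        exact mul_le_mul (hb1 i) (hb1 j) (abs_nonneg _) (norm_nonneg _)
      linarith
    have := Matrix.det_le (A := Y * Y.transpose) (abv := IsAbsoluteValue.toAbsoluteValue (abs : ℝ → ℝ)) (x := X) hent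
    simpa [hC] using this
  rw [hdet1, abs_mul, abs_of_nonneg (sq_nonneg _)] at hone
  rw [div_le_iff₀ hC0]
  exact hone.trans (mul_le_mul_of_nonneg_left hYb (sq_nonneg _))

lemma aux_Dmin_pos {m : ℕ} (b : Fin (m + 1) → Euc (m + 1)) (hb : LinearIndependent ℝ b) :
    0 < Dmin (polarLattice (latticeOf b)) := by
  obtain ⟨d, hd⟩ := aux_dual b hb
  have hdli := aux_dual_li b d hd
  have hdm : ∀ i, d i ∈ polarLattice (latticeOf b) := by
    intro i
    apply aux_mem_polar
    intro j
    rw [hd]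
    exact ⟨if i = j then 1 else 0, by split_ifs <;> simp⟩
  have hpos : ∀ i : Fin (m + 1),
      0 < minSublatticeDet (polarLattice (latticeOf b)) ((i : ℕ) + 1) := by
    intro i
    obtain ⟨κ, hκ, h⟩ := aux_lower b hb ((i : ℕ) + 1)
    refine lt_of_lt_of_le hκ (le_csInf ?_ ?_)
    · have hi : (i : ℕ) + 1 ≤ m + 1 := i.2
      exact ⟨_, d ∘ Fin.castLE hi, hdli.comp _ (Fin.castLE_injective hi), fun j => hdm _, rfl⟩
    · rintro _ ⟨c, hc, hm, rfl⟩
      exact h c hc hm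
  have hset : {d : ℝ | ∃ i : Fin (m + 1), d = minSublatticeDet (polarLattice (latticeOf b))
      ((i : ℕ) + 1) ^ ((1 : ℝ) / ((i : ℕ) + 1))} =
      Set.range (fun i : Fin (m + 1) => minSublatticeDet (polarLattice (latticeOf b))
      ((i : ℕ) + 1) ^ ((1 : ℝ) / ((i : ℕ) + 1))) := by
    ext x; constructor
    · rintro ⟨i, rfl⟩; exact ⟨i, rfl⟩
    · rintro ⟨i, rfl⟩; exact ⟨i, rfl⟩
  have hmem := Set.Nonempty.csInf_mem (Set.range_nonempty (fun i : Fin (m + 1) =>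
      minSublatticeDet (polarLattice (latticeOf b))
      ((i : ℕ) + 1) ^ ((1 : ℝ) / ((i : ℕ) + 1)))) (Set.finite_range _)
  unfold Dmin
  rw [hset]
  obtain ⟨i, hi⟩ := hmem
  rw [← hi]
  exact Real.rpow_pos_of_pos (hpos i) _

lemma aux_polar (b v d : Fin n → Euc n) (Z : Matrix (Fin n) (Fin n) ℤ)
    (hv : ∀ k, v k = ∑ j, (Z j k : ℝ) • b j)
    (hd : ∀ i j, ⟪d i, v j⟫ = if i = j then (1 : ℝ) else 0) (i : Fin n) :
    (Z.det : ℝ) • d i ∈ polarLattice (latticeOf b) := by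
  apply aux_mem_polar
  intro j
  let P : Matrix (Fin n) (Fin n) ℝ := Matrix.of fun i j => ⟪d i, b j⟫
  let ZR : Matrix (Fin n) (Fin n) ℝ := Z.map (Int.castRingHom ℝ)
  have h1 : P * ZR = 1 := by
    ext i k
    rw [Matrix.mul_apply, Matrix.one_apply, ← hd i k, hv k]
    simp [P, ZR, inner_sum, real_inner_smul_right, mul_comm]
  have h2 : ZR.det • P = ZR.adjugate := by
    calc ZR.det • P = P * (ZR * ZR.adjugate) := by rw [Matrix.mul_adjugate]; simp
      _ = _ := by rw [← Matrix.mul_assoc, h1, Matrix.one_mul]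
  have h3 : ZR.det = (Z.det : ℝ) := by
    have := RingHom.map_det (Int.castRingHom ℝ) Z
    rw [eq_intCast] at this
    exact this.symm
  have h4 : ZR.adjugate = Z.adjugate.map (Int.castRingHom ℝ) :=
    (RingHom.map_adjugate (Int.castRingHom ℝ) Z).symm
  refine ⟨Z.adjugate i j, ?_⟩
  have h5 := congrFun (congrFun h2 i) j
  rw [h4, h3] at h5
  rw [real_inner_smul_left]
  simpa [P] using h5

lemma aux_detV (b v : Fin n → Euc n) (Z : Matrix (Fin n) (Fin n) ℤ)
    (hv : ∀ k, v k = ∑ j, (Z j k : ℝ) • b j) :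
    |Matrix.det (Matrix.of fun i j => v j i)| = |(Z.det : ℝ)| * latticeDet b := by
  have h1 : (Matrix.of fun i j => v j i : Matrix (Fin n) (Fin n) ℝ) =
      (Matrix.of fun i j => b j i) * Z.map (Int.castRingHom ℝ) := by
    ext i k
    rw [Matrix.mul_apply, Matrix.of_apply, hv k]
    simp [mul_comm]
  have h3 : (Z.map (Int.castRingHom ℝ)).det = (Z.det : ℝ) := by
    have := RingHom.map_det (Int.castRingHom ℝ) Z
    rw [eq_intCast] at this
    exact this.symm
  rw [h1, Matrix.det_mul, abs_mul, h3, latticeDet, mul_comm]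

lemma aux_greedy (S : ℕ → Set (Euc n)) (k : ℕ)
    (h : ∀ i < k, ∃ v : Fin (i + 1) → Euc n, LinearIndependent ℝ v ∧ ∀ j, v j ∈ S i) :
    ∃ v : Fin k → Euc n, LinearIndependent ℝ v ∧ ∀ i : Fin k, v i ∈ S i := by
  induction k with
  | zero => exact ⟨fun i => i.elim0, linearIndependent_empty_type, fun i => i.elim0⟩
  | succ k ih =>
    obtain ⟨v, hv, hvS⟩ := ih (fun i hi => h i (by omega))
    obtain ⟨w, hw, hwS⟩ := h k (by omega)
    have : ∃ j, w j ∉ Submodule.span ℝ (Set.range v) := by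
      by_contra hcon
      push Not at hcon
      have h1 : Submodule.span ℝ (Set.range w) ≤ Submodule.span ℝ (Set.range v) := by
        rw [Submodule.span_le]; rintro _ ⟨j, rfl⟩; exact hcon j
      have h2 := Submodule.finrank_mono h1
      rw [finrank_span_eq_card hw, finrank_span_eq_card hv] at h2
      simp at h2
    obtain ⟨j, hj⟩ := this
    refine ⟨Fin.snoc v (w j), linearIndependent_finSnoc.2 ⟨hv, hj⟩, ?_⟩
    intro i
    refine Fin.lastCases ?_ (fun i => ?_) i
    · simpa using hwS j
    · simpa using hvS i

lemma aux_esym (m : ℕ) (l : Fin (m + 1) → ℝ) (hl : ∀ i, 0 < l i) :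
    esym (m + 1) m (fun i => ((l i)⁻¹) ^ 2) = (∑ i, l i ^ 2) / (∏ i, l i) ^ 2 := by
  unfold esym
  rw [Finset.sum_div]
  symm
  apply Finset.sum_bij (fun i _ => Finset.univ.erase i)
  · intro i _
    simp [Finset.mem_powersetCard]
  · intro i _ j _ hij
    by_contra hne
    have : i ∈ Finset.univ.erase j := by simp [hne]
    rw [← hij] at this
    simp at this
  · intro J hJ
    rw [Finset.mem_powersetCard] at hJ
    have : (Jᶜ).card = 1 := by rw [Finset.card_compl, hJ.2]; simp
    obtain ⟨i, hi⟩ := Finset.card_eq_one.1 this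
    refine ⟨i, Finset.mem_univ _, ?_⟩
    rw [← compl_compl J, hi, Finset.compl_singleton]
  · intro i _
    rw [← Finset.mul_prod_erase Finset.univ l (Finset.mem_univ i), Finset.prod_pow,
      Finset.prod_inv_distrib]
    have h1 := (hl i).ne'
    have h2 : ∏ x ∈ Finset.univ.erase i, l x ≠ 0 := Finset.prod_ne_zero_iff.2 fun j _ => (hl j).ne'
    field_simp
lemma aux_ball {K : Set (Euc n)} (hc : Convex ℝ K) (hi : (interior K).Nonempty) (hsym : K = -K) :
    ∃ r : ℝ, 0 < r ∧ Metric.ball 0 r ⊆ K := by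
  obtain ⟨x, hx⟩ := hi
  have hx' : -x ∈ K := by
    rw [hsym]; simpa using interior_subset hx
  have h0 : (0 : Euc n) ∈ interior K := by
    have := hc.combo_interior_self_mem_interior hx hx' (a := 1 / 2) (b := 1 / 2)
      (by norm_num) (by norm_num) (by norm_num)
    simpa using this
  obtain ⟨r, hr, h⟩ := Metric.mem_nhds_iff.1 (mem_interior_iff_mem_nhds.1 h0)
  exact ⟨r, hr, h⟩

/-- The set of admissible dilations. -/
def TSet (K Λ : Set (Euc n)) (i : ℕ) : Set ℝ :=
  {t : ℝ | 0 < t ∧ ∃ v : Fin i → Euc n,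
    LinearIndependent ℝ v ∧ ∀ j, v j ∈ Λ ∧ v j ∈ t • K}

lemma aux_T_nonempty {K : Set (Euc n)} (hc : Convex ℝ K) (hi : (interior K).Nonempty)
    (hsym : K = -K) (b : Fin n → Euc n) (hb : LinearIndependent ℝ b) (i : ℕ) (hin : i ≤ n) :
    (TSet K (latticeOf b) i).Nonempty := by
  obtain ⟨r, hr, h⟩ := aux_ball hc hi hsym
  have hs : 0 < ∑ j, ‖b j‖ + 1 := by positivity
  refine ⟨(∑ j, ‖b j‖ + 1) / r, by positivity, b ∘ Fin.castLE hin,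
    hb.comp _ (Fin.castLE_injective hin), fun j => ⟨aux_mem_latticeOf b _, ?_⟩⟩
  rw [mem_smul_set_iff_inv_smul_mem₀ (by positivity)]
  apply h
  rw [mem_ball_zero_iff, norm_smul, Real.norm_of_nonneg (by positivity)]
  have : ‖(b ∘ Fin.castLE hin) j‖ ≤ ∑ j, ‖b j‖ :=
    Finset.single_le_sum (f := fun j => ‖b j‖) (fun _ _ => norm_nonneg _) (Finset.mem_univ _)
  rw [inv_div, div_mul_eq_mul_div, div_lt_iff₀ hs]
  nlinarith

lemma aux_T_up {K : Set (Euc n)} (hc : Convex ℝ K) (h0 : (0 : Euc n) ∈ K) (Λ : Set (Euc n)) (i : ℕ)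
    (s t : ℝ) (hs : s ∈ TSet K Λ i) (hst : s ≤ t) : t ∈ TSet K Λ i := by
  obtain ⟨hs0, v, hv, hvm⟩ := hs
  have ht0 := hs0.trans_le hst
  refine ⟨ht0, v, hv, fun j => ⟨(hvm j).1, ?_⟩⟩
  obtain ⟨y, hy, hyv⟩ := (hvm j).2
  refine ⟨(s / t) • y, ?_, ?_⟩
  · exact hc.smul_mem_of_zero_mem h0 hy ⟨by positivity, (div_le_one ht0).2 hst⟩
  · change s • y = v j at hyv
    change t • (s / t) • y = v j
    rw [← hyv, smul_smul, mul_div_cancel₀ _ ht0.ne']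

lemma aux_T_lower {K : Set (Euc n)} (hk : IsCompact K) (b : Fin n → Euc n)
    (hb : LinearIndependent ℝ b) :
    ∃ κ : ℝ, 0 < κ ∧ ∀ i, ∀ t ∈ TSet K (latticeOf b) (i + 1), κ ≤ t := by
  obtain ⟨d, hd⟩ := aux_dual b hb
  obtain ⟨R, hR0, hR⟩ := hk.isBounded.exists_pos_norm_le
  have hs : 0 < ∑ j, ‖d j‖ + 1 := by positivity
  refine ⟨1 / ((∑ j, ‖d j‖ + 1) * R), by positivity, ?_⟩
  rintro i t ⟨ht, v, hv, hvm⟩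
  obtain ⟨⟨z, hz⟩, ⟨y, hy, hyv⟩⟩ := hvm 0
  have hne := hv.ne_zero 0
  have : ∃ j, z j ≠ 0 := by
    by_contra hcon
    push Not at hcon
    apply hne
    rw [hz]; simp [hcon]
  obtain ⟨j, hj⟩ := this
  have h1 : ⟪d j, v 0⟫ = z j := by
    rw [hz]; simp [inner_sum, real_inner_smul_right, hd]
  have h2 : (1 : ℝ) ≤ |(z j : ℝ)| := by exact_mod_cast Int.one_le_abs hj
  have h3 := abs_real_inner_le_norm (d j) (v 0)
  rw [h1] at h3
  have h4 : ‖v 0‖ ≤ t * R := by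
    rw [← hyv]
    simp only [norm_smul, Real.norm_of_nonneg ht.le]
    exact mul_le_mul_of_nonneg_left (hR y hy) ht.le
  have h5 : ‖d j‖ ≤ ∑ j, ‖d j‖ + 1 := by
    have := Finset.single_le_sum (f := fun j => ‖d j‖) (fun _ _ => norm_nonneg _) (Finset.mem_univ j)
    linarith
  rw [div_le_iff₀ (by positivity)]
  calc 1 ≤ ‖d j‖ * ‖v 0‖ := h2.trans h3
    _ ≤ (∑ j, ‖d j‖ + 1) * (t * R) := mul_le_mul h5 h4 (norm_nonneg _) hs.le
    _ = _ := by ring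

lemma aux_T_anti (K Λ : Set (Euc n)) (i j : ℕ) (hij : i ≤ j) : TSet K Λ j ⊆ TSet K Λ i := by
  rintro t ⟨ht, v, hv, hvm⟩
  exact ⟨ht, v ∘ Fin.castLE hij, hv.comp _ (Fin.castLE_injective hij), fun l => hvm _⟩

lemma aux_core {m : ℕ} {K : Set (Euc (m + 1))} (hc : Convex ℝ K) (hk : IsCompact K)
    (hne : K.Nonempty) (hsym : K = -K)
    (b : Fin (m + 1) → Euc (m + 1)) (hb : LinearIndependent ℝ b)
    (t : Fin (m + 1) → ℝ) (ht : ∀ i, 0 < t i) (hmono : Monotone t)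
    (v : Fin (m + 1) → Euc (m + 1)) (hv : LinearIndependent ℝ v)
    (hvm : ∀ i, v i ∈ latticeOf b ∧ v i ∈ t i • K) :
    2 ^ (m + 1) / (m.factorial : ℝ) * (Dmin (polarLattice (latticeOf b)) * latticeDet b) *
      (Real.sqrt (∑ i, t i ^ 2) / ∏ i, t i) ≤ surfaceArea K := by
  choose Z' hZ' using fun i => (hvm i).1
  let Z : Matrix (Fin (m + 1)) (Fin (m + 1)) ℤ := Matrix.of fun j k => Z' k j
  have hZ : ∀ k, v k = ∑ j, (Z j k : ℝ) • b j := fun k => hZ' k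
  obtain ⟨d, hd⟩ := aux_dual v hv
  have hdli := aux_dual_li v d hd
  have hdetV := aux_detV b v Z hZ
  have hdetV0 := aux_detne v hv
  have hZ0 : (Z.det : ℝ) ≠ 0 := by
    intro h0
    rw [h0, abs_zero, zero_mul, abs_eq_zero] at hdetV
    exact hdetV0 hdetV
  have hprod : 0 < ∏ i, t i := Finset.prod_pos fun i _ => ht i
  have hW : Matrix.det (Matrix.of fun i j => ((t j)⁻¹ • v j) i) =
      (∏ i, t i)⁻¹ * Matrix.det (Matrix.of fun i j => v j i) := by
    have := Matrix.det_mul_row (fun j => (t j)⁻¹)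
      (Matrix.of fun i j => v j i : Matrix (Fin (m + 1)) (Fin (m + 1)) ℝ)
    rw [Finset.prod_inv_distrib] at this
    rw [← this]
    rfl
  have hlay : ∀ e : ℝ, e > 0 → e * _ ≤ _ := fun e he => aux_layers hc hk hsym (fun i => (t i)⁻¹ • v i) (fun i => t i • d i)
    (fun i => by
      have := (hvm i).2
      rwa [mem_smul_set_iff_inv_smul_mem₀ (ht i).ne'] at this)
    (fun i j => by
      rw [real_inner_smul_left, real_inner_smul_right, hd]
      split_ifs with h
      · subst h; field_simp [(ht i).ne']
      · simp)
    (by rw [hW]; exact mul_ne_zero (inv_ne_zero hprod.ne') hdetV0) e he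
  have hS := aux_surface hc hk hne _ hlay
  refine le_trans ?_ hS
  have hx := aux_signs (polarLattice (latticeOf b)) (fun i => (Z.det : ℝ) • d i)
    (by
      have := hdli.units_smul (fun _ => Units.mk0 (Z.det : ℝ) hZ0)
      exact this)
    (fun i => aux_polar b v d Z hZ hd i) t ht hmono (aux_Dmin_pos b hb)
  have hx2 : ∀ e : Fin (m + 1) → Bool, ‖∑ i, sg (e i) • t i • (Z.det : ℝ) • d i‖ =
      |(Z.det : ℝ)| * ‖∑ i, sg (e i) • t i • d i‖ := by
    intro e
    rw [← Real.norm_eq_abs, ← norm_smul, Finset.smul_sum]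
    congr 1
    apply Finset.sum_congr rfl
    intro i _
    simp only [smul_smul]
    congr 1; ring
  simp only [hx2] at hx
  rw [← Finset.mul_sum] at hx
  rw [hW, abs_mul, hdetV, abs_of_pos (inv_pos.2 hprod)]
  have hL : 0 ≤ latticeDet b := abs_nonneg _
  rw [← Finset.sum_div, ← Finset.sum_mul]
  have key := mul_le_mul_of_nonneg_left hx
    (show 0 ≤ latticeDet b * (∏ i, t i)⁻¹ / (m.factorial : ℝ) by positivity)
  refine le_trans (le_of_eq ?_) (le_trans key (le_of_eq ?_))
  · field_simp
  · field_simp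

lemma aux_main {m : ℕ} (K : Set (Euc (m + 1)))
    (hK : IsConvexBody K) (hsym : K = -K)
    (b : Fin (m + 1) → Euc (m + 1)) (hb : LinearIndependent ℝ b) :
    ((2 : ℝ) ^ (m + 1) / m.factorial) *
        Real.sqrt (esym (m + 1) m fun i =>
          ((succMin K (latticeOf b) ((i : ℕ) + 1))⁻¹) ^ 2) ≤
    surfaceArea K / (Dmin (polarLattice (latticeOf b)) * latticeDet b) := by
  obtain ⟨hc, hk, hi⟩ := hK
  have hDp := aux_Dmin_pos b hb
  have hLp : 0 < latticeDet b := abs_pos.2 (aux_detne b hb)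
  obtain ⟨r, hr, hball⟩ := aux_ball hc hi hsym
  have h0 : (0 : Euc (m + 1)) ∈ K := hball (by simpa using hr)
  set l : Fin (m + 1) → ℝ := fun i => succMin K (latticeOf b) ((i : ℕ) + 1) with hl
  have hT : ∀ i, succMin K (latticeOf b) i = sInf (TSet K (latticeOf b) i) := fun i => rfl
  obtain ⟨κ, hκ, hlow⟩ := aux_T_lower hk b hb
  have hbdd : ∀ i, BddBelow (TSet K (latticeOf b) i) := fun i => ⟨0, fun t ht => ht.1.le⟩
  have hnon := aux_T_nonempty hc hi hsym b hb
  have hlpos : ∀ i, 0 < l i := by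
    intro i
    simp only [hl, hT]
    exact hκ.trans_le (le_csInf (hnon _ i.2) (hlow _))
  have hlmono : Monotone l := by
    intro i j hij
    simp only [hl, hT]
    exact csInf_le_csInf (hbdd _) (hnon _ j.2)
      (aux_T_anti _ _ _ _ (Nat.succ_le_succ (Fin.le_def.1 hij)))
  rw [aux_esym m l hlpos]
  have hP : 0 < ∏ i, l i := Finset.prod_pos fun i _ => hlpos i
  rw [Real.sqrt_div' _ (sq_nonneg _), Real.sqrt_sq hP.le]
  have hstep : ∀ δ : ℝ, 0 < δ →
      2 ^ (m + 1) / (m.factorial : ℝ) * (Dmin (polarLattice (latticeOf b)) * latticeDet b) *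
      (Real.sqrt (∑ i, l i ^ 2) / ∏ i, l i) ≤ surfaceArea K * (1 + δ) ^ m := by
    intro δ hδ
    have hd1 : 0 < 1 + δ := by linarith
    have hex : ∀ i < m + 1, ∃ v : Fin (i + 1) → Euc (m + 1), LinearIndependent ℝ v ∧
        ∀ j, v j ∈ latticeOf b ∩ ((1 + δ) * succMin K (latticeOf b) (i + 1)) • K := by
      intro i hi
      have hlt : sInf (TSet K (latticeOf b) (i + 1)) < (1 + δ) * succMin K (latticeOf b) (i + 1) := by
        rw [← hT]
        have := hlpos ⟨i, hi⟩
        simp only [hl] at this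
        nlinarith
      obtain ⟨s, hs, hst⟩ := exists_lt_of_csInf_lt (hnon _ hi) hlt
      obtain ⟨_, v, hv, hvm⟩ := aux_T_up hc h0 _ _ s _ hs hst.le
      exact ⟨v, hv, hvm⟩
    obtain ⟨v, hv, hvm⟩ := aux_greedy _ _ hex
    have := aux_core hc hk ⟨0, h0⟩ hsym b hb (fun i => (1 + δ) * l i)
      (fun i => mul_pos hd1 (hlpos i)) (fun i j hij => mul_le_mul_of_nonneg_left (hlmono hij) hd1.le)
      v hv hvm
    have e1 : Real.sqrt (∑ i, ((1 + δ) * l i) ^ 2) = (1 + δ) * Real.sqrt (∑ i, l i ^ 2) := by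
      simp only [mul_pow]
      rw [← Finset.mul_sum, Real.sqrt_mul (sq_nonneg _), Real.sqrt_sq hd1.le]
    have e2 : ∏ i, ((1 + δ) * l i) = (1 + δ) ^ (m + 1) * ∏ i, l i := by
      rw [Finset.prod_mul_distrib]; simp
    rw [e1, e2] at this
    refine le_trans (le_of_eq ?_) (mul_le_mul_of_nonneg_right this (pow_pos hd1 m).le)
    field_simp
    ring
  have hlim : 2 ^ (m + 1) / (m.factorial : ℝ) * (Dmin (polarLattice (latticeOf b)) * latticeDet b) *
      (Real.sqrt (∑ i, l i ^ 2) / ∏ i, l i) ≤ surfaceArea K := by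
    have hcont : Continuous fun δ : ℝ => surfaceArea K * (1 + δ) ^ m := by fun_prop
    have ht : Tendsto (fun δ : ℝ => surfaceArea K * (1 + δ) ^ m) (nhdsWithin 0 (Ioi 0))
        (nhds (surfaceArea K)) := by
      have := (hcont.tendsto 0).mono_left (nhdsWithin_le_nhds (s := Ioi (0 : ℝ)))
      simpa using this
    refine ge_of_tendsto ht ?_
    filter_upwards [self_mem_nhdsWithin] with δ hδ
    exact hstep δ hδ
  rw [le_div_iff₀ (mul_pos hDp hLp)]
  refine le_trans (le_of_eq ?_) hlim
  ring

/-- **Theorem (surface area, arbitrary lattices).**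
`S(K)/(D_min(Λ^⋆)·det Λ) ≥ (2^n/(n-1)!)·√(σ_{n-1}(λ_1^{-2},…,λ_n^{-2}))`. -/
theorem statement12 {n : ℕ} (hn : 0 < n) (K : Set (Euc n))
    (hK : IsConvexBody K) (hsym : K = -K)
    (b : Fin n → Euc n) (hb : LinearIndependent ℝ b) :
    surfaceArea K / (Dmin (polarLattice (latticeOf b)) * latticeDet b) ≥
      ((2 : ℝ) ^ n / (n - 1).factorial) *
        Real.sqrt (esym n (n - 1) fun i =>
          ((succMin K (latticeOf b) ((i : ℕ) + 1))⁻¹) ^ 2) := by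
  obtain ⟨m, rfl⟩ : ∃ m, n = m + 1 := ⟨n - 1, by omega⟩
  exact aux_main K hK hsym b hb

end Paper
end
end

section
/- There exists an absolute constant c > 0 such that for every n, every o-symmetric convex body K in ℝ^n and every lattice Λ of rank n in ℝ^n, writing λ_i = λ_i(K,Λ), one has S(K)/D_{n−1}(Λ) ≥ (c/√n)·(2^n/(n−1)!)·√(σ_{n−1}(λ_1^{−2},…,λ_n^{−2})). -/
open MeasureTheory Set Filter Pointwise RealInnerProductSpace
open scoped ENNReal

noncomputable section

namespace Paper

variable {n : ℕ}

structure Body (K : Set (Euc n)) : Prop where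
  conv : Convex ℝ K
  comp : IsCompact K
  symm : ∀ x ∈ K, -x ∈ K
  nhd : K ∈ nhds (0 : Euc n)

lemma Body.absorbent {K : Set (Euc n)} (h : Body K) : Absorbent ℝ K :=
  absorbent_nhds_zero h.nhd

lemma Body.zero_mem {K : Set (Euc n)} (h : Body K) : (0 : Euc n) ∈ K := mem_of_mem_nhds h.nhd

lemma Body.of {K : Set (Euc n)} (h : IsConvexBody K) (hs : K = -K) : Body K := by
  obtain ⟨hc, hk, x, hx⟩ := h
  have hsy : ∀ x ∈ K, -x ∈ K := by
    intro x hx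
    rw [hs]; simpa using hx
  refine ⟨hc, hk, hsy, ?_⟩
  have h1 : (0 : Euc n) ∈ interior K := by
    have := hc.combo_interior_self_mem_interior hx (hsy x (interior_subset hx))
      (a := 1/2) (b := 1/2) (by norm_num) (by norm_num) (by norm_num)
    simpa using this
  exact mem_interior_iff_mem_nhds.mp h1

lemma Body.balanced {K : Set (Euc n)} (h : Body K) : Balanced ℝ K := by
  intro a ha x hx
  obtain ⟨y, hy, rfl⟩ := hx
  simp only [Real.norm_eq_abs] at ha
  rcases le_total 0 a with h0 | h0
  · rw [abs_of_nonneg h0] at ha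
    exact h.conv.smul_mem_of_zero_mem h.zero_mem hy ⟨h0, ha⟩
  · rw [abs_of_nonpos h0] at ha
    have := h.conv.smul_mem_of_zero_mem h.zero_mem (h.symm y hy) (t := -a) ⟨by linarith, ha⟩
    simpa using this

lemma Body.vol {K : Set (Euc n)} (h : Body K) :
    volume K = ENNReal.ofReal ((∫ x, Real.exp (-gauge K x)) / Real.Gamma (n + 1)) := by
  have h1 : volume K = volume {x | gauge K x < 1} := by
    rw [setOfPred_gauge_lt_one_eq_interior h.conv h.nhd]
    exact (measure_congr (interior_ae_eq_of_null_frontier (h.conv.addHaar_frontier _))).symm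
  have h2 := MeasureTheory.measure_lt_one_eq_integral_div_gamma (E := Euc n) volume
    (g := gauge K) gauge_zero (gauge_neg h.symm) (gauge_add_le h.conv h.absorbent)
    (fun {x} hx => (gauge_eq_zero h.absorbent
      ((NormedSpace.isVonNBounded_iff ℝ).2 h.comp.isBounded)).1 hx)
    (fun r x => (gauge_smul h.balanced r x).le) (p := 1) one_pos
  rw [h1, h2]
  simp

lemma Body.vol_real {K : Set (Euc n)} (h : Body K) :
    (volume K).toReal = (∫ x, Real.exp (-gauge K x)) / Real.Gamma (n + 1) := by
  rw [h.vol, ENNReal.toReal_ofReal]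
  apply div_nonneg
  · exact integral_nonneg fun x => (Real.exp_pos _).le
  · exact (Real.Gamma_pos_of_pos (by positivity)).le

lemma Body.vol_pos {K : Set (Euc n)} (h : Body K) : 0 < volume K :=
  Measure.measure_pos_of_mem_nhds _ h.nhd

lemma Body.integrable {K : Set (Euc n)} (h : Body K) :
    Integrable (fun x => Real.exp (-gauge K x)) := by
  by_contra hc
  have h1 := h.vol
  rw [integral_undef hc] at h1
  have := h.vol_pos
  simp [h1] at this

lemma Body.add {K : Set (Euc n)} (h : Body K) {ε : ℝ} (he : 0 ≤ ε) :
    Body (K + Metric.closedBall (0 : Euc n) ε) := by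
  refine ⟨h.conv.add (convex_closedBall _ _), h.comp.add (isCompact_closedBall _ _), ?_, ?_⟩
  · rintro x ⟨k, hk, y, hy, rfl⟩
    refine ⟨-k, h.symm k hk, -y, by simpa using hy, ?_⟩
    simp only; abel
  · refine Filter.mem_of_superset h.nhd fun x hx => ⟨x, hx, 0, by simpa using he, by simp⟩

lemma Body.smul {K : Set (Euc n)} (h : Body K) {a : ℝ} (ha : 0 < a) : Body (a • K) := by
  refine ⟨h.conv.smul a, h.comp.smul a, ?_, ?_⟩
  · rintro x ⟨k, hk, rfl⟩
    exact ⟨-k, h.symm k hk, by simp⟩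
  · exact set_smul_mem_nhds_zero_iff ha.ne' |>.2 h.nhd

lemma Body.ball {K : Set (Euc n)} (h : Body K) :
    ∃ r : ℝ, 0 < r ∧ Metric.closedBall (0 : Euc n) r ⊆ K := Metric.nhds_basis_closedBall.mem_iff.1 h.nhd

lemma gauge_smul_set {K : Set (Euc n)} {a : ℝ} (ha : 0 < a) (x : Euc n) :
    gauge (a • K) x = a⁻¹ * gauge K x := by
  rw [gauge_smul_left_of_nonneg ha.le]; simp

/-- convexity in ε -/
lemma gauge_conv {K : Set (Euc n)} (h : Body K) {ε δ : ℝ} (he : 0 < ε) (hd : ε ≤ δ) (x : Euc n) :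
    gauge (K + Metric.closedBall (0 : Euc n) ε) x ≤
      (1 - ε / δ) * gauge K x + (ε / δ) * gauge (K + Metric.closedBall (0 : Euc n) δ) x := by
  have hdp : 0 < δ := he.trans_le hd
  set t := ε / δ with ht
  have ht0 : 0 < t := by positivity
  have ht1 : t ≤ 1 := (div_le_one hdp).2 hd
  have key : ∀ η > 0, gauge (K + Metric.closedBall (0 : Euc n) ε) x ≤
      (1 - t) * (gauge K x + η) + t * (gauge (K + Metric.closedBall (0 : Euc n) δ) x + η) := by
    intro η hη
    obtain ⟨α, ha, haη, hα⟩ := exists_lt_of_gauge_lt h.absorbent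
      (show gauge K x < gauge K x + η by linarith)
    obtain ⟨β, hb, hbη, hβ⟩ := exists_lt_of_gauge_lt (h.add hdp.le).absorbent
      (show gauge (K + Metric.closedBall (0 : Euc n) δ) x <
        gauge (K + Metric.closedBall (0 : Euc n) δ) x + η by linarith)
    obtain ⟨k1, hk1, hx1⟩ := hα
    obtain ⟨_, ⟨k2, hk2, y, hy, rfl⟩, hx2⟩ := hβ
    simp only at hx1 hx2
    have hmem : ((1 - t) * α⁻¹ + t * β⁻¹) • x ∈ K + Metric.closedBall (0 : Euc n) ε := by
      refine ⟨(1 - t) • k1 + t • k2, h.conv hk1 hk2 (by linarith) ht0.le (by ring),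
        t • y, ?_, ?_⟩
      · simp only [Metric.mem_closedBall, dist_zero_right] at hy ⊢
        rw [norm_smul, Real.norm_of_nonneg ht0.le]
        calc t * ‖y‖ ≤ t * δ := by gcongr
          _ = ε := by rw [ht]; field_simp
      · have e1 : k1 = α⁻¹ • x := by rw [← hx1, smul_smul, inv_mul_cancel₀ ha.ne', one_smul]
        have e2 : k2 + y = β⁻¹ • x := by rw [← hx2, smul_smul, inv_mul_cancel₀ hb.ne', one_smul]
        simp only
        rw [add_smul, mul_smul, mul_smul, ← e1, ← e2, smul_add, add_assoc]
    set s := (1 - t) * α⁻¹ + t * β⁻¹ with hs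
    have hs0 : 0 < s := by
      have : 0 ≤ (1 - t) * α⁻¹ := mul_nonneg (by linarith) (by positivity)
      positivity
    have h1 : gauge (K + Metric.closedBall (0 : Euc n) ε) x ≤ s⁻¹ := by
      apply gauge_le_of_mem (by positivity)
      exact ⟨s • x, hmem, by simp [smul_smul, inv_mul_cancel₀ hs0.ne']⟩
    have h2 : s⁻¹ ≤ (1 - t) * α + t * β := by
      rw [inv_le_iff_one_le_mul₀ hs0, hs]
      have : ((1 - t) * α + t * β) * ((1 - t) * α⁻¹ + t * β⁻¹) - 1 =
          t * (1 - t) * (α - β) ^ 2 * (α⁻¹ * β⁻¹) := by field_simp; ring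
      have h3 : 0 ≤ t * (1 - t) * (α - β) ^ 2 * (α⁻¹ * β⁻¹) := by
        have : 0 ≤ 1 - t := by linarith
        positivity
      linarith
    have h3 : (1 - t) * α ≤ (1 - t) * (gauge K x + η) :=
      mul_le_mul_of_nonneg_left haη.le (by linarith)
    have h4 := mul_le_mul_of_nonneg_left hbη.le ht0.le
    linarith
  refine le_of_forall_pos_le_add fun η hη => ?_
  have := key η hη
  linarith

lemma gauge_lower {K : Set (Euc n)} (h : Body K) {r ε : ℝ} (hr : 0 < r)
    (hb : Metric.closedBall (0 : Euc n) r ⊆ K) (he : 0 < ε) (x : Euc n) :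
    (1 + ε / r)⁻¹ * gauge K x ≤ gauge (K + Metric.closedBall (0 : Euc n) ε) x := by
  have hp : 0 < 1 + ε / r := by positivity
  rw [← gauge_smul_set hp]
  refine gauge_mono (h.add he.le).absorbent ?_ x
  rw [h.conv.add_smul zero_le_one (by positivity), one_smul]
  refine Set.add_subset_add_left ?_
  have : Metric.closedBall (0 : Euc n) ε = (ε / r) • Metric.closedBall (0 : Euc n) r := by
    rw [smul_closedBall _ _ hr.le, smul_zero, Real.norm_of_nonneg (by positivity)]
    congr 1; field_simp
  rw [this]
  exact Set.smul_set_mono hb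

lemma gauge_upper {K : Set (Euc n)} (h : Body K) {ε : ℝ} (he : 0 < ε) (x : Euc n) :
    gauge (K + Metric.closedBall (0 : Euc n) ε) x ≤ gauge K x :=
  gauge_mono h.absorbent (fun x hx =>
    show x ∈ K + Metric.closedBall (0 : Euc n) ε from ⟨x, hx, 0, by simpa using he.le, by simp⟩) x

lemma slope_bound {K : Set (Euc n)} (h : Body K) {r ε : ℝ} (hr : 0 < r)
    (hb : Metric.closedBall (0 : Euc n) r ⊆ K) (he : 0 < ε) (x : Euc n) :
    gauge K x - gauge (K + Metric.closedBall (0 : Euc n) ε) x ≤ ε / r * gauge K x := by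
  have h1 := gauge_lower h hr hb he x
  have h2 := gauge_upper h he x
  have hp : 0 < 1 + ε / r := by positivity
  rw [inv_mul_le_iff₀ hp] at h1
  have : ε / r * gauge (K + Metric.closedBall (0 : Euc n) ε) x ≤ ε / r * gauge K x := by gcongr
  linarith

lemma pointwise_lim {K : Set (Euc n)} (h : Body K) (x : Euc n) :
    ∃ d, Tendsto (fun ε : ℝ => (Real.exp (-gauge (K + Metric.closedBall (0 : Euc n) ε) x)
      - Real.exp (-gauge K x)) / ε) (nhdsWithin 0 (Ioi 0)) (nhds d) := by
  obtain ⟨r, hr, hb⟩ := h.ball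
  set g : ℝ → ℝ := fun ε => gauge (K + Metric.closedBall (0 : Euc n) ε) x with hg
  have hg0 : g 0 = gauge K x := by simp [hg]
  have hanti : AntitoneOn (fun ε => (g 0 - g ε) / ε) (Ioi 0) := by
    intro a ha b hb' hab
    simp only [mem_Ioi] at ha hb'
    have := gauge_conv h ha hab x
    simp only
    rw [div_le_div_iff₀ hb' ha, hg0]
    have e : (b * ((1 - a / b) * gauge K x + a / b * g b)) = (b - a) * gauge K x + a * g b := by
      field_simp
    have := mul_le_mul_of_nonneg_left this hb'.le
    rw [e] at this
    have e2 : g a = gauge (K + Metric.closedBall (0 : Euc n) a) x := rfl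
    rw [← e2] at this
    linarith
  have hbdd : BddAbove ((fun ε => (g 0 - g ε) / ε) '' Ioi 0) := by
    refine ⟨gauge K x / r, ?_⟩
    rintro _ ⟨ε, he, rfl⟩
    simp only [mem_Ioi] at he
    have := slope_bound h hr hb he x
    simp only
    rw [hg0, div_le_iff₀ he]
    calc _ ≤ _ := this
      _ = _ := by ring
  have ht := hanti.tendsto_nhdsGT hbdd
  set D := sSup ((fun ε => (g 0 - g ε) / ε) '' Ioi 0)
  have hd : HasDerivWithinAt g (-D) (Ioi 0) 0 := by
    rw [hasDerivWithinAt_iff_tendsto_slope' (by simp)]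
    refine ht.neg.congr fun ε => ?_
    simp only [slope, vsub_eq_sub, smul_eq_mul, sub_zero]
    ring
  have hd2 := hd.neg.exp
  rw [hasDerivWithinAt_iff_tendsto_slope' (by simp)] at hd2
  refine ⟨_, hd2.congr fun ε => ?_⟩
  simp only [slope, vsub_eq_sub, smul_eq_mul, sub_zero, Pi.neg_apply, hg0]
  rw [div_eq_inv_mul]

lemma limit_exists {K : Set (Euc n)} (h : Body K) :
    ∃ L, Tendsto (fun ε : ℝ => ((volume (Metric.cthickening ε K)).toReal - (volume K).toReal) / ε)
      (nhdsWithin 0 (Ioi 0)) (nhds L) := by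
  obtain ⟨r, hr, hb⟩ := h.ball
  choose d hd using pointwise_lim h
  have hmain : Tendsto (fun ε : ℝ => ∫ x, (Real.exp (-gauge (K + Metric.closedBall (0 : Euc n) ε) x)
      - Real.exp (-gauge K x)) / ε) (nhdsWithin 0 (Ioi 0)) (nhds (∫ x, d x)) := by
    refine tendsto_integral_filter_of_dominated_convergence
      (fun x => 4 / r * Real.exp (-gauge ((4:ℝ) • K) x)) ?_ ?_ ?_ ?_
    · filter_upwards [self_mem_nhdsWithin] with ε he
      simp only [mem_Ioi] at he
      have c1 := continuous_gauge (h.add he.le).conv (h.add he.le).nhd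
      have c2 := continuous_gauge h.conv h.nhd
      exact Continuous.aestronglyMeasurable (by fun_prop)
    · filter_upwards [Ioo_mem_nhdsGT hr] with ε he
      refine Filter.Eventually.of_forall fun x => ?_
      obtain ⟨he, her⟩ := he
      have h1 := gauge_lower h hr hb he x
      have h2 := gauge_upper h he x
      have h3 := slope_bound h hr hb he x
      rw [gauge_smul_set (by norm_num)]
      set G := gauge K x
      have hG : 0 ≤ G := gauge_nonneg _
      set g := gauge (K + Metric.closedBall (0 : Euc n) ε) x
      have h4 : G / 2 ≤ g := by
        refine le_trans ?_ h1
        rw [div_eq_inv_mul]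
        gcongr
        have : ε / r ≤ 1 := (div_le_one hr).2 her.le
        linarith
      have h5 : 0 ≤ Real.exp (-g) - Real.exp (-G) := by
        have := Real.exp_le_exp.2 (show -G ≤ -g by linarith)
        linarith
      rw [Real.norm_of_nonneg (by positivity), div_le_iff₀ he]
      have h6 : Real.exp (-G) = Real.exp (-g) * Real.exp (-(G - g)) := by
        rw [← Real.exp_add]; congr 1; ring
      have h7 : 1 - (G - g) ≤ Real.exp (-(G - g)) := by
        have := Real.add_one_le_exp (-(G - g)); linarith
      have h8 : Real.exp (-g) ≤ Real.exp (-(G/4)) * Real.exp (-(G/4)) := by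
        rw [← Real.exp_add]
        apply Real.exp_le_exp.2; linarith
      have h9 : G / 4 * Real.exp (-(G/4)) ≤ 1 := by
        have := Real.add_one_le_exp (G/4)
        rw [Real.exp_neg, ← div_eq_mul_inv, div_le_one (Real.exp_pos _)]
        linarith
      have hE : 0 < Real.exp (-(G/4)) := Real.exp_pos _
      calc Real.exp (-g) - Real.exp (-G) = Real.exp (-g) * (1 - Real.exp (-(G - g))) := by
            rw [h6]; ring
        _ ≤ Real.exp (-g) * (ε / r * G) := by gcongr; linarith
        _ ≤ (Real.exp (-(G/4)) * Real.exp (-(G/4))) * (ε / r * G) := by gcongr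
        _ = 4 * (ε / r) * Real.exp (-(G/4)) * (G / 4 * Real.exp (-(G/4))) := by ring
        _ ≤ 4 * (ε / r) * Real.exp (-(G/4)) * 1 := by gcongr
        _ = 4 / r * Real.exp (-(4⁻¹ * G)) * ε := by
            rw [show 4⁻¹ * G = G / 4 by ring]; ring
    · exact (h.smul (by norm_num)).integrable.const_mul _
    · exact Filter.Eventually.of_forall hd
  refine ⟨_, (hmain.div_const (Real.Gamma (n + 1))).congr' ?_⟩
  filter_upwards [self_mem_nhdsWithin] with ε he
  simp only [mem_Ioi] at he
  rw [← IsCompact.add_closedBall_zero h.comp he.le, h.vol_real, (h.add he.le).vol_real,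
    integral_div, integral_sub (h.add he.le).integrable h.integrable]
  ring

lemma surfaceArea_tendsto {K : Set (Euc n)} (h : Body K) :
    Tendsto (fun ε : ℝ => ((volume (Metric.cthickening ε K)).toReal - (volume K).toReal) / ε)
      (nhdsWithin 0 (Ioi 0)) (nhds (surfaceArea K)) := by
  obtain ⟨L, hL⟩ := limit_exists h
  have : surfaceArea K = L := hL.limUnder_eq
  rwa [this]

lemma oned {A A' : Set ℝ} {ε : ℝ} (he : 0 < ε) (hA : IsCompact A) (hne : A.Nonempty)
    (h : ∀ a ∈ A, ∀ s, |s| ≤ ε → a + s ∈ A') :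
    volume A + ENNReal.ofReal (2 * ε) ≤ volume A' := by
  obtain ⟨M, hM, hMA⟩ := hA.exists_isGreatest hne
  obtain ⟨q, hq, hqA⟩ := hA.exists_isLeast hne
  have hsub : (A ∪ Ioc M (M + ε)) ∪ Ico (q - ε) q ⊆ A' := by
    rintro x ((hx | hx) | hx)
    · simpa using h x hx 0 (by simpa using he.le)
    · have := h M hM (x - M) (by rw [abs_le]; constructor <;> linarith [hx.1, hx.2])
      simpa using this
    · have := h q hq (x - q) (by rw [abs_le]; constructor <;> linarith [hx.1, hx.2])
      simpa using this
  refine le_trans (le_of_eq ?_) (measure_mono hsub)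
  rw [measure_union, measure_union]
  · rw [Real.volume_Ioc, Real.volume_Ico, add_assoc, ← ENNReal.ofReal_add (by linarith) (by linarith)]
    congr 2; ring
  · rw [Set.disjoint_left]
    intro x hx hx'
    exact absurd (hMA hx) (not_le.2 hx'.1)
  · exact measurableSet_Ioc
  · rw [Set.disjoint_left]
    rintro x (hx | hx) hx'
    · exact absurd (hqA hx) (not_le.2 hx'.2)
    · have := hqA hM
      linarith [hx.1, hx'.2]
  · exact measurableSet_Ico

lemma prodslice {m : ℕ} {T T' : Set (ℝ × (Fin m → ℝ))} {P : Set (Fin m → ℝ)} {ε : ℝ} (he : 0 < ε)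
    (hT : IsCompact T) (hT' : MeasurableSet T') (hP : MeasurableSet P)
    (hPT : ∀ y ∈ P, ((0 : ℝ), y) ∈ T)
    (h : ∀ a ∈ T, ∀ s : ℝ, |s| ≤ ε → (a.1 + s, a.2) ∈ T') :
    volume T + ENNReal.ofReal (2 * ε) * volume P ≤ volume T' := by
  rw [Measure.volume_eq_prod, Measure.prod_apply_symm hT.measurableSet,
    Measure.prod_apply_symm hT', ← lintegral_indicator_const hP, ← lintegral_add_right]
  · refine lintegral_mono fun y => ?_
    by_cases hy : y ∈ P
    · rw [indicator_of_mem hy]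
      refine oned he ?_ ⟨0, hPT y hy⟩ fun a ha s hs => h (a, y) ha s hs
      refine (hT.image continuous_fst).of_isClosed_subset
        (hT.isClosed.preimage (by fun_prop)) ?_
      intro a ha
      exact ⟨(a, y), ha, rfl⟩
    · rw [indicator_of_notMem hy, add_zero]
      refine measure_mono fun a ha => ?_
      have := h (a, y) ha 0 (by simpa using he.le)
      simpa using this
  · exact measurable_const.indicator hP

lemma cross_vol (m : ℕ) : ENNReal.ofReal ((2 : ℝ) ^ m / m.factorial) =
    volume {y : Fin m → ℝ | ∑ i, |y i| < 1} := by
  have := MeasureTheory.volume_sum_rpow_lt_one (Fin m) (p := 1) le_rfl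
  simp only [Real.rpow_one, Fintype.card_fin, div_one] at this
  rw [this]
  congr 2
  · norm_num [Real.Gamma_two]
  · exact (Real.Gamma_nat_eq_factorial m).symm

/-- matrix with columns -/
def colMat {m : ℕ} (x : Euc (m + 1)) (c : Fin m → Euc (m + 1)) :
    Matrix (Fin (m + 1)) (Fin (m + 1)) ℝ :=
  Matrix.of fun i j => (Fin.cons x c : Fin (m + 1) → Euc (m + 1)) j i

def gr {k n : ℕ} (c : Fin k → Euc n) : ℝ := Matrix.det (Matrix.of fun k l => ⟪c k, c l⟫)

lemma colMat_det {m : ℕ} (x y : Euc (m + 1)) (c : Fin m → Euc (m + 1)) (hx : ∀ j, ⟪x, c j⟫ = 0) :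
    (colMat x c).det * (colMat y c).det = ⟪x, y⟫ * gr c := by
  have h : (colMat x c).transpose * colMat y c = Matrix.of fun i j =>
      ⟪(Fin.cons x c : Fin (m + 1) → Euc (m + 1)) i, (Fin.cons y c : Fin (m + 1) → Euc (m + 1)) j⟫ := by
    ext i j
    simp [colMat, Matrix.mul_apply, PiLp.inner_apply, mul_comm]
  rw [← Matrix.det_transpose (colMat x c), ← Matrix.det_mul, h, Matrix.det_succ_row_zero,
    Fin.sum_univ_succ]
  simp only [Matrix.of_apply, Fin.cons_zero, Fin.cons_succ, hx]
  simp [gr]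
  left
  congr 1

lemma exists_normal {m : ℕ} (c : Fin m → Euc (m + 1)) :
    ∃ ν : Euc (m + 1), ‖ν‖ = 1 ∧ ∀ j, ⟪ν, c j⟫ = 0 := by
  set S := Submodule.span ℝ (range c)
  have h1 : Module.finrank ℝ S ≤ m := by
    have := finrank_range_le_card (R := ℝ) c
    simpa [Set.finrank] using this
  have h2 := S.finrank_add_finrank_orthogonal
  rw [finrank_euclideanSpace_fin] at h2
  have h3 : 0 < Module.finrank ℝ Sᗮ := by omega
  have := Module.finrank_pos_iff.1 h3
  obtain ⟨⟨x, hx⟩, hx0⟩ := exists_ne (0 : Sᗮ)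
  have hx0 : x ≠ 0 := fun h => hx0 (by simp [h])
  refine ⟨(‖x‖⁻¹ : ℝ) • x, ?_, fun j => ?_⟩
  · rw [norm_smul, norm_inv, norm_norm, inv_mul_cancel₀ (norm_ne_zero_iff.2 hx0)]
  · rw [real_inner_smul_left]
    have := (Submodule.mem_orthogonal' S x).1 hx (c j) (Submodule.subset_span ⟨j, rfl⟩)
    rw [this, mul_zero]

lemma gr_pos {k n : ℕ} {c : Fin k → Euc n} (h : LinearIndependent ℝ c) : 0 < gr c := by
  have := (Matrix.posDef_gram_of_linearIndependent (𝕜 := ℝ) h).det_pos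
  exact this

/-- coordinates map -/
def Phi {m : ℕ} (ν : Euc (m + 1)) (c : Fin m → Euc (m + 1)) (p : ℝ × (Fin m → ℝ)) : Euc (m + 1) :=
  p.1 • ν + ∑ j, p.2 j • c j

lemma Phi_eq {m : ℕ} (ν : Euc (m + 1)) (c : Fin m → Euc (m + 1)) (p : ℝ × (Fin m → ℝ)) :
    Phi ν c p = WithLp.toLp 2 (Matrix.toLin' (colMat ν c)
      ((MeasurableEquiv.piFinSuccAbove (fun _ : Fin (m + 1) => ℝ) 0).symm p)) := by
  ext i
  simp [Phi, colMat, Matrix.mulVec, dotProduct, Fin.sum_univ_succ,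
    MeasurableEquiv.piFinSuccAbove, mul_comm]

lemma vol_Phi {m : ℕ} {ν : Euc (m + 1)} {c : Fin m → Euc (m + 1)} (hdet : (colMat ν c).det ≠ 0)
    {K : Set (Euc (m + 1))} (hK : MeasurableSet K) :
    volume K = ENNReal.ofReal |(colMat ν c).det| * volume (Phi ν c ⁻¹' K) := by
  have h1 : Phi ν c ⁻¹' K = (MeasurableEquiv.piFinSuccAbove (fun _ : Fin (m + 1) => ℝ) 0).symm ⁻¹'
      (Matrix.toLin' (colMat ν c) ⁻¹' (WithLp.toLp 2 ⁻¹' K)) := by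
    ext p; simp only [mem_preimage, Phi_eq]
  have hm : MeasurableSet ((WithLp.toLp 2 : (Fin (m+1) → ℝ) → Euc (m + 1)) ⁻¹' K) :=
    (PiLp.volume_preserving_toLp (Fin (m+1))).measurable hK
  have hd : LinearMap.det (Matrix.toLin' (colMat ν c)) ≠ 0 := by rwa [LinearMap.det_toLin']
  rw [h1, ((volume_preserving_piFinSuccAbove (fun _ : Fin (m + 1) => ℝ) 0).symm _).measure_preimage
    ?_, Measure.addHaar_preimage_linearMap _ hd,
    (PiLp.volume_preserving_toLp (Fin (m+1))).measure_preimage hK.nullMeasurableSet,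
    LinearMap.det_toLin', ← mul_assoc, ← ENNReal.ofReal_mul (abs_nonneg _), ← abs_mul,
    mul_inv_cancel₀ hdet]
  · simp
  · exact ((LinearMap.continuous_of_finiteDimensional _).measurable hm).nullMeasurableSet

lemma vol_growth {m : ℕ} {K : Set (Euc (m + 1))} (h : Body K) {w : Fin m → Euc (m + 1)}
    (hw : LinearIndependent ℝ w) (hwK : ∀ j, w j ∈ K) {ε : ℝ} (he : 0 < ε) :
    (2 : ℝ) ^ (m + 1) / m.factorial * √(gr w) ≤
    ((volume (Metric.cthickening ε K)).toReal - (volume K).toReal) / ε := by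
  obtain ⟨ν, hν, hνw⟩ := exists_normal w
  have hsq := colMat_det ν ν w hνw
  rw [real_inner_self_eq_norm_sq, hν, one_pow, one_mul] at hsq
  have hG := gr_pos hw
  have hdet : (colMat ν w).det ≠ 0 := by
    intro h0; rw [h0] at hsq; simp at hsq; linarith
  have habs : |(colMat ν w).det| = √(gr w) := by
    rw [← hsq, Real.sqrt_mul_self_eq_abs]
  have hbody := h.add he.le
  rw [IsCompact.add_closedBall_zero h.comp he.le] at hbody
  have hcont : Continuous (Phi ν w) := by unfold Phi; fun_prop
  have hTc : IsCompact (Phi ν w ⁻¹' K) := by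
    have e : Phi ν w ⁻¹' K = (fun x : Euc (m + 1) =>
        (MeasurableEquiv.piFinSuccAbove (fun _ : Fin (m + 1) => ℝ) 0)
          ((colMat ν w)⁻¹.mulVec (WithLp.ofLp x))) '' K := by
      have hu : IsUnit (colMat ν w).det := isUnit_iff_ne_zero.2 hdet
      ext p
      simp only [mem_preimage, mem_image]
      constructor
      · intro hp
        refine ⟨_, hp, ?_⟩
        rw [Phi_eq]
        simp [Matrix.mulVec_mulVec, Matrix.nonsing_inv_mul _ hu]
      · rintro ⟨x, hx, rfl⟩
        rw [Phi_eq, MeasurableEquiv.symm_apply_apply]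
        simpa [Matrix.mulVec_mulVec, Matrix.mul_nonsing_inv _ hu] using hx
    rw [e]
    refine h.comp.image ?_
    refine Continuous.prodMk ?_ ?_
    · have : Continuous fun x : Euc (m + 1) => (colMat ν w)⁻¹.mulVec (WithLp.ofLp x) := by
        fun_prop
      exact (continuous_apply 0).comp this
    · have : Continuous fun x : Euc (m + 1) => (colMat ν w)⁻¹.mulVec (WithLp.ofLp x) := by
        fun_prop
      refine continuous_pi fun j => ?_
      exact (continuous_apply _).comp this
  have hPm : MeasurableSet {y : Fin m → ℝ | ∑ i, |y i| < 1} := by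
    refine measurableSet_lt (Continuous.measurable (by fun_prop)) measurable_const
  have key := prodslice (T := Phi ν w ⁻¹' K) (T' := Phi ν w ⁻¹' (Metric.cthickening ε K))
    (P := {y : Fin m → ℝ | ∑ i, |y i| < 1}) he hTc
    (hcont.measurable hbody.comp.measurableSet) hPm ?_ ?_
  · rw [← cross_vol] at key
    have hKf : volume K ≠ ⊤ := h.comp.measure_lt_top.ne
    have hKf' : volume (Metric.cthickening ε K) ≠ ⊤ := hbody.comp.measure_lt_top.ne
    have key2 := mul_le_mul_right key (ENNReal.ofReal |(colMat ν w).det|)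
    rw [mul_add, ← vol_Phi hdet h.comp.measurableSet, ← vol_Phi hdet hbody.comp.measurableSet,
      ← ENNReal.ofReal_mul (by positivity), ← ENNReal.ofReal_mul (by positivity)] at key2
    have key3 := ENNReal.toReal_mono hKf' key2
    rw [ENNReal.toReal_add hKf ENNReal.ofReal_ne_top, ENNReal.toReal_ofReal (by positivity), habs]
      at key3
    rw [le_div_iff₀ he]
    have : √(gr w) * (2 * ε * (2 ^ m / (m.factorial : ℝ))) = 2 ^ (m + 1) / (m.factorial : ℝ) * √(gr w) * ε := by
      rw [pow_succ]; ring
    linarith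
  · intro y hy
    simp only [mem_ofPred_eq] at hy
    simp only [mem_preimage, Phi, zero_smul, zero_add]
    have hle : gauge K (∑ j, y j • w j) ≤ 1 := by
      refine (gauge_sum_le h.conv h.absorbent _ _).trans ?_
      refine le_trans (Finset.sum_le_sum fun j _ => ?_) hy.le
      rw [gauge_smul h.balanced, Real.norm_eq_abs]
      exact mul_le_of_le_one_right (abs_nonneg _) (gauge_le_one_of_mem (hwK j))
    have := (gauge_le_one_iff_mem_closure h.conv h.nhd).1 hle
    rwa [h.comp.isClosed.closure_eq] at this
  · intro a ha s hs
    simp only [mem_preimage] at ha ⊢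
    rw [← IsCompact.add_closedBall_zero h.comp he.le]
    refine ⟨_, ha, s • ν, ?_, ?_⟩
    · simpa [norm_smul, hν] using hs
    · simp only [Phi, add_smul]; abel

lemma surface_lower {m : ℕ} {K : Set (Euc (m + 1))} (h : Body K) {w : Fin m → Euc (m + 1)}
    (hw : LinearIndependent ℝ w) (hwK : ∀ j, w j ∈ K) :
    (2 : ℝ) ^ (m + 1) / m.factorial * √(gr w) ≤ surfaceArea K := by
  refine ge_of_tendsto (surfaceArea_tendsto h) ?_
  filter_upwards [self_mem_nhdsWithin] with ε he
  exact vol_growth h hw hwK he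

lemma colMat_det_ne {m : ℕ} {x : Euc (m + 1)} {c : Fin m → Euc (m + 1)}
    (hc : LinearIndependent ℝ c) (hx : x ∉ Submodule.span ℝ (range c)) :
    (colMat x c).det ≠ 0 := by
  have hli : LinearIndependent ℝ (Fin.cons x c : Fin (m + 1) → Euc (m + 1)) :=
    linearIndependent_finCons.2 ⟨hc, hx⟩
  have hli2 := hli.map' (WithLp.linearEquiv 2 ℝ (Fin (m + 1) → ℝ)).toLinearMap
    (LinearEquiv.ker _)
  have h2 : LinearIndependent ℝ (colMat x c).transpose.row := hli2
  rw [Matrix.linearIndependent_rows_iff_isUnit] at h2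
  rw [Matrix.isUnit_iff_isUnit_det, Matrix.det_transpose] at h2
  exact h2.ne_zero

lemma latticeDet_ne {n : ℕ} {b : Fin n → Euc n} (hb : LinearIndependent ℝ b) :
    Matrix.det (Matrix.of fun i j => b j i) ≠ 0 := by
  have hli2 := hb.map' (WithLp.linearEquiv 2 ℝ (Fin n → ℝ)).toLinearMap
    (LinearEquiv.ker _)
  have h2 : LinearIndependent ℝ (Matrix.of fun i j => b j i : Matrix (Fin n) (Fin n) ℝ).transpose.row := hli2
  rw [Matrix.linearIndependent_rows_iff_isUnit] at h2
  rw [Matrix.isUnit_iff_isUnit_det, Matrix.det_transpose] at h2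
  exact h2.ne_zero

lemma mem_latticeOf {n : ℕ} (b : Fin n → Euc n) (i : Fin n) : b i ∈ latticeOf b :=
  ⟨Pi.single i 1, by simp [Pi.single_apply]⟩

lemma det_lattice {n : ℕ} (b : Fin n → Euc n) (v : Fin n → Euc n) (hv : ∀ j, v j ∈ latticeOf b)
    (hdet : Matrix.det (Matrix.of fun i j => v j i) ≠ 0) :
    |Matrix.det (Matrix.of fun i j => b j i)| ≤ |Matrix.det (Matrix.of fun i j => v j i)| := by
  choose z hz using hv
  have e : (Matrix.of fun i j => v j i : Matrix (Fin n) (Fin n) ℝ) =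
      (Matrix.of fun i j => b j i) * (Matrix.of fun i j => z j i : Matrix (Fin n) (Fin n) ℤ).map (Int.castRingHom ℝ) := by
    ext i j
    simp [Matrix.mul_apply, hz j, mul_comm]
  rw [e, Matrix.det_mul, ← RingHom.mapMatrix_apply, ← RingHom.map_det] at hdet
  rw [e, Matrix.det_mul, ← RingHom.mapMatrix_apply, ← RingHom.map_det, abs_mul]
  have hne : (Matrix.of fun i j => z j i : Matrix (Fin n) (Fin n) ℤ).det ≠ 0 := by
    intro h0
    rw [h0] at hdet; simp at hdet
  have h1 : (1 : ℝ) ≤ |(Int.castRingHom ℝ) (Matrix.of fun i j => z j i : Matrix (Fin n) (Fin n) ℤ).det| := by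
    have := Int.one_le_abs hne
    simp only [Int.coe_castRingHom]
    exact_mod_cast this
  exact le_mul_of_one_le_right (abs_nonneg _) h1

lemma gr_lower {m : ℕ} {b : Fin (m + 1) → Euc (m + 1)} (hb : LinearIndependent ℝ b) :
    ∃ κ : ℝ, 0 < κ ∧ ∀ c : Fin m → Euc (m + 1), LinearIndependent ℝ c → (∀ j, c j ∈ latticeOf b) →
      κ ≤ √(gr c) := by
  have hd := latticeDet_ne hb
  have hs : 0 < ∑ i, ‖b i‖ := by
    refine Finset.sum_pos (fun i _ => norm_pos_iff.2 (hb.ne_zero i)) ⟨0, Finset.mem_univ _⟩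
  refine ⟨|Matrix.det (Matrix.of fun i j => b j i)| / ∑ i, ‖b i‖, by positivity, fun c hc hcL => ?_⟩
  obtain ⟨i, hi⟩ : ∃ i, b i ∉ Submodule.span ℝ (range c) := by
    by_contra! hcon
    have h1 : Submodule.span ℝ (range b) ≤ Submodule.span ℝ (range c) :=
      Submodule.span_le.2 (by rintro _ ⟨i, rfl⟩; exact hcon i)
    have h2 := Submodule.finrank_mono h1
    rw [finrank_span_eq_card hb, finrank_span_eq_card hc] at h2
    simp at h2
  have h1 := colMat_det_ne hc hi
  have h2 := det_lattice b (Fin.cons (b i) c) (fun j => by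
    refine Fin.cases ?_ (fun j => ?_) j
    · exact mem_latticeOf b i
    · exact hcL j) h1
  obtain ⟨ν, hν, hνw⟩ := exists_normal c
  have hsq := colMat_det ν ν c hνw
  have hsq2 := colMat_det ν (b i) c hνw
  rw [real_inner_self_eq_norm_sq, hν, one_pow, one_mul] at hsq
  have hG := gr_pos hc
  have h3 : (colMat (b i) c).det ^ 2 = ⟪ν, b i⟫ ^ 2 * gr c := by
    have : gr c * (colMat (b i) c).det ^ 2 = gr c * (⟪ν, b i⟫ ^ 2 * gr c) := by
      calc _ = ((colMat ν c).det * (colMat (b i) c).det) ^ 2 := by rw [← hsq]; ring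
        _ = _ := by rw [hsq2]; ring
    exact mul_left_cancel₀ hG.ne' this
  have h4 : |(colMat (b i) c).det| = |⟪ν, b i⟫| * √(gr c) := by
    rw [← Real.sqrt_sq_eq_abs, h3, Real.sqrt_mul (sq_nonneg _), Real.sqrt_sq_eq_abs]
  have h5 : |⟪ν, b i⟫| ≤ ∑ i, ‖b i‖ := by
    refine (abs_real_inner_le_norm _ _).trans ?_
    rw [hν, one_mul]
    exact Finset.single_le_sum (f := fun i => ‖b i‖) (fun _ _ => norm_nonneg _) (Finset.mem_univ i)
  rw [div_le_iff₀ hs]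
  calc _ ≤ _ := h2
    _ = |(colMat (b i) c).det| := rfl
    _ ≤ _ := by rw [h4, mul_comm]; gcongr

lemma minDet_le {n k : ℕ} {Λ : Set (Euc n)} {c : Fin k → Euc n} (hc : LinearIndependent ℝ c)
    (hcL : ∀ j, c j ∈ Λ) : minSublatticeDet Λ k ≤ √(gr c) := by
  refine csInf_le ⟨0, ?_⟩ ⟨c, hc, hcL, rfl⟩
  rintro _ ⟨c, _, _, rfl⟩
  exact Real.sqrt_nonneg _

lemma minDet_pos {m : ℕ} {b : Fin (m + 1) → Euc (m + 1)} (hb : LinearIndependent ℝ b) :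
    0 < minSublatticeDet (latticeOf b) m := by
  obtain ⟨κ, hκ, h⟩ := gr_lower hb
  refine hκ.trans_le (le_csInf ?_ ?_)
  · exact ⟨_, fun j => b j.castSucc, hb.comp _ (Fin.castSucc_injective _),
      fun j => mem_latticeOf b _, rfl⟩
  · rintro _ ⟨c, hc, hcL, rfl⟩
    exact h c hc hcL

def mset (K Λ : Set (Euc n)) (i : ℕ) : Set ℝ := {t : ℝ | 0 < t ∧ ∃ v : Fin i → Euc n,
    LinearIndependent ℝ v ∧ ∀ j, v j ∈ Λ ∧ v j ∈ t • K}

lemma mset_anti (K Λ : Set (Euc n)) {i j : ℕ} (h : i ≤ j) : mset K Λ j ⊆ mset K Λ i := by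
  rintro t ⟨ht, v, hv, hvm⟩
  exact ⟨ht, fun k => v (Fin.castLE h k), hv.comp _ (Fin.castLE_injective h), fun k => hvm _⟩

lemma Body.smul_mono {K : Set (Euc n)} (h : Body K) {s t : ℝ} (hs : 0 < s) (hst : s ≤ t) :
    s • K ⊆ t • K := by
  apply h.balanced.smul_mono
  rwa [Real.norm_of_nonneg hs.le, Real.norm_of_nonneg (hs.le.trans hst)]

lemma mset_nonempty {K : Set (Euc n)} (h : Body K) {b : Fin n → Euc n}
    (hb : LinearIndependent ℝ b) {i : ℕ} (hi : i ≤ n) : (mset K (latticeOf b) i).Nonempty := by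
  obtain ⟨r, hr, hball⟩ := h.ball
  refine Set.Nonempty.mono (mset_anti _ _ hi) ?_
  refine ⟨(1 + ∑ i, ‖b i‖) / r, ?_, b, hb, fun j => ⟨mem_latticeOf b j, ?_⟩⟩
  · have : 0 ≤ ∑ i, ‖b i‖ := Finset.sum_nonneg fun _ _ => norm_nonneg _
    positivity
  · have h0 : 0 ≤ ∑ i, ‖b i‖ := Finset.sum_nonneg fun _ _ => norm_nonneg _
    have hp : 0 < (1 + ∑ i, ‖b i‖) / r := by positivity
    rw [Set.mem_smul_set_iff_inv_smul_mem₀ hp.ne']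
    apply hball
    rw [mem_closedBall_zero_iff, norm_smul, norm_inv, Real.norm_of_nonneg hp.le,
      inv_mul_le_iff₀ hp, div_mul_cancel₀ _ hr.ne']
    have := Finset.single_le_sum (f := fun i => ‖b i‖) (fun _ _ => norm_nonneg _) (Finset.mem_univ j)
    linarith

lemma mset_bdd (K Λ : Set (Euc n)) (i : ℕ) : BddBelow (mset K Λ i) := ⟨0, fun _ ht => ht.1.le⟩

lemma succMin_nonneg (K Λ : Set (Euc n)) (i : ℕ) : 0 ≤ succMin K Λ i :=
  Real.sInf_nonneg fun _ ht => ht.1.le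

lemma succMin_mono {K : Set (Euc n)} (h : Body K) {b : Fin n → Euc n}
    (hb : LinearIndependent ℝ b) {i j : ℕ} (hij : i ≤ j) (hj : j ≤ n) :
    succMin K (latticeOf b) i ≤ succMin K (latticeOf b) j :=
  csInf_le_csInf (mset_bdd _ _ _) (mset_nonempty h hb hj) (mset_anti _ _ hij)

lemma greedy {K : Set (Euc n)} (h : Body K) {b : Fin n → Euc n}
    (hb : LinearIndependent ℝ b) {δ : ℝ} (hδ : 0 < δ) (k : ℕ) (hk : k ≤ n) :
    ∃ v : Fin k → Euc n, LinearIndependent ℝ v ∧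
      ∀ j, v j ∈ latticeOf b ∧ v j ∈ (succMin K (latticeOf b) ((j : ℕ) + 1) + δ) • K := by
  induction k with
  | zero => exact ⟨Fin.elim0, linearIndependent_empty_type, fun j => j.elim0⟩
  | succ k ih =>
    obtain ⟨v, hv, hvm⟩ := ih (by omega)
    obtain ⟨t, ⟨ht0, u, hu, hum⟩, htl⟩ := exists_lt_of_csInf_lt (mset_nonempty h hb hk)
      (show sInf (mset K (latticeOf b) (k + 1)) < sInf (mset K (latticeOf b) (k + 1)) + δ by linarith)
    obtain ⟨i, hi⟩ : ∃ i, u i ∉ Submodule.span ℝ (range v) := by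
      by_contra! hcon
      have h1 : Submodule.span ℝ (range u) ≤ Submodule.span ℝ (range v) :=
        Submodule.span_le.2 (by rintro _ ⟨i, rfl⟩; exact hcon i)
      have h2 := Submodule.finrank_mono h1
      rw [finrank_span_eq_card hu, finrank_span_eq_card hv] at h2
      simp at h2
    refine ⟨Fin.snoc v (u i), linearIndependent_finSnoc.2 ⟨hv, hi⟩, fun j => ?_⟩
    refine Fin.lastCases ?_ (fun j => ?_) j
    · simp only [Fin.snoc_last, Fin.val_last]
      exact ⟨(hum i).1, h.smul_mono ht0 htl.le (hum i).2⟩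
    · simpa using hvm j

lemma gr_smul {k n : ℕ} (s : Fin k → ℝ) (v : Fin k → Euc n) :
    gr (fun j => s j • v j) = (∏ j, s j) ^ 2 * gr v := by
  have : (Matrix.of fun i j => ⟪s i • v i, s j • v j⟫ : Matrix (Fin k) (Fin k) ℝ) =
      Matrix.diagonal s * (Matrix.of fun i j => ⟪v i, v j⟫) * Matrix.diagonal s := by
    ext i j
    simp [Matrix.mul_diagonal, Matrix.diagonal_mul, real_inner_smul_left, real_inner_smul_right]
    ring
  unfold gr
  rw [this, Matrix.det_mul, Matrix.det_mul, Matrix.det_diagonal]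
  ring

lemma main_delta {m : ℕ} {K : Set (Euc (m + 1))} (h : Body K) {b : Fin (m + 1) → Euc (m + 1)}
    (hb : LinearIndependent ℝ b) {δ : ℝ} (hδ : 0 < δ) :
    (2 : ℝ) ^ (m + 1) / m.factorial * minSublatticeDet (latticeOf b) m ≤
      surfaceArea K * ∏ j : Fin m, (succMin K (latticeOf b) ((j : ℕ) + 1) + δ) := by
  obtain ⟨v, hv, hvm⟩ := greedy h hb hδ m (by omega)
  set s : Fin m → ℝ := fun j => succMin K (latticeOf b) ((j : ℕ) + 1) + δ with hs
  have hsp : ∀ j, 0 < s j := fun j => by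
    have := succMin_nonneg K (latticeOf b) ((j : ℕ) + 1)
    simp only [hs]; linarith
  have hw : LinearIndependent ℝ (fun j => (s j)⁻¹ • v j) := by
    have := hv.units_smul (fun j => Units.mk0 (s j)⁻¹ (inv_ne_zero (hsp j).ne'))
    exact this
  have h1 := surface_lower h hw (fun j => by
    rw [← Set.mem_smul_set_iff_inv_smul_mem₀ (hsp j).ne']
    exact (hvm j).2)
  have h2 := minDet_le hv (fun j => (hvm j).1)
  have hP : 0 < ∏ j, s j := Finset.prod_pos fun j _ => hsp j
  rw [gr_smul, Real.sqrt_mul (sq_nonneg _), Real.sqrt_sq_eq_abs, Finset.prod_inv_distrib,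
    abs_of_pos (inv_pos.2 hP)] at h1
  calc _ ≤ (2 : ℝ) ^ (m + 1) / m.factorial * √(gr v) := by gcongr
    _ = (2 : ℝ) ^ (m + 1) / m.factorial * ((∏ j, s j)⁻¹ * √(gr v)) * ∏ j, s j := by
      field_simp
    _ ≤ _ := by gcongr

lemma main_lim {m : ℕ} {K : Set (Euc (m + 1))} (h : Body K) {b : Fin (m + 1) → Euc (m + 1)}
    (hb : LinearIndependent ℝ b) :
    (2 : ℝ) ^ (m + 1) / m.factorial * minSublatticeDet (latticeOf b) m ≤
      surfaceArea K * ∏ j : Fin m, succMin K (latticeOf b) ((j : ℕ) + 1) := by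
  have hc : Continuous fun δ : ℝ =>
      surfaceArea K * ∏ j : Fin m, (succMin K (latticeOf b) ((j : ℕ) + 1) + δ) := by fun_prop
  have ht := (hc.tendsto 0).mono_left (nhdsWithin_le_nhds (s := Ioi 0))
  simp only [add_zero] at ht
  refine ge_of_tendsto ht ?_
  filter_upwards [self_mem_nhdsWithin] with δ hδ
  exact main_delta h hb hδ

lemma esym_le {m : ℕ} (l : ℕ → ℝ) (hl : ∀ j < m, 0 < l j)
    (hmono : ∀ i j, i ≤ j → j ≤ m → l i ≤ l j) :
    esym (m + 1) m (fun i => ((l i)⁻¹) ^ 2) ≤ (m + 1) * (∏ j : Fin m, (l j)⁻¹) ^ 2 := by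
  unfold esym
  refine (Finset.sum_le_card_nsmul _ _ ((∏ j : Fin m, (l j)⁻¹) ^ 2) ?_).trans (le_of_eq ?_)
  · intro J hJ
    have hJ := (Finset.mem_powersetCard.1 hJ).2
    have e : J = Finset.univ.map (J.orderEmbOfFin hJ).toEmbedding := by
      simp
    rw [e, Finset.prod_map, ← Finset.prod_pow]
    refine Finset.prod_le_prod (fun i _ => sq_nonneg _) fun i _ => ?_
    have h1 : (i : ℕ) ≤ (J.orderEmbOfFin hJ i : ℕ) := by
      have hsm : StrictMono (fun i : Fin m => ((J.orderEmbOfFin hJ i : Fin (m + 1)) : ℕ)) :=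
        fun a b hab => (J.orderEmbOfFin hJ).strictMono hab
      obtain ⟨i, hi⟩ := i
      induction i with
      | zero => exact Nat.zero_le _
      | succ i ih =>
        have h5 : i ≤ (J.orderEmbOfFin hJ ⟨i, by omega⟩ : ℕ) := ih (by omega) (Finset.mem_univ _)
        have h2 := hsm (show (⟨i, by omega⟩ : Fin m) < ⟨i + 1, hi⟩ by simp)
        simp only at h2 ⊢
        omega
    have h2 := hmono _ _ h1 (by omega)
    have h3 := hl i i.2
    have h4 := h3.trans_le h2
    simp only [RelEmbedding.coe_toEmbedding]
    gcongr
  · rw [Finset.card_powersetCard]; simp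

theorem statement13 :
    ∃ c : ℝ, 0 < c ∧ ∀ n : ℕ, 0 < n → ∀ K : Set (Euc n), IsConvexBody K → K = -K →
      ∀ b : Fin n → Euc n, LinearIndependent ℝ b →
        surfaceArea K / minSublatticeDet (latticeOf b) (n - 1) ≥
          (c / Real.sqrt n) * ((2 : ℝ) ^ n / (n - 1).factorial) *
            Real.sqrt (esym n (n - 1) fun i =>
              ((succMin K (latticeOf b) ((i : ℕ) + 1))⁻¹) ^ 2) := by
  refine ⟨1, one_pos, fun n hn K hK hs b hb => ?_⟩
  obtain ⟨m, rfl⟩ : ∃ m, n = m + 1 := ⟨n - 1, by omega⟩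
  have h := Body.of hK hs
  have hD := minDet_pos hb
  have hmain := main_lim h hb
  simp only [Nat.add_sub_cancel]
  set D := minSublatticeDet (latticeOf b) m
  set S := surfaceArea K
  set C : ℝ := (2 : ℝ) ^ (m + 1) / m.factorial with hC
  have hCp : 0 < C := by positivity
  set l : ℕ → ℝ := fun i => succMin K (latticeOf b) (i + 1) with hl
  set P := ∏ j : Fin m, l j with hP
  have hP0 : 0 ≤ P := Finset.prod_nonneg fun j _ => succMin_nonneg _ _ _
  have hSP : 0 < S * P := (mul_pos hCp hD).trans_le hmain
  have hPp : 0 < P := by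
    rcases hP0.eq_or_lt with h0 | h0
    · rw [← h0] at hSP; simp at hSP
    · exact h0
  have hlp : ∀ j < m, 0 < l j := by
    intro j hj
    refine lt_of_le_of_ne (succMin_nonneg _ _ _) fun h0 => hPp.ne' ?_
    exact Finset.prod_eq_zero (Finset.mem_univ (⟨j, hj⟩ : Fin m)) h0.symm
  have he := esym_le l hlp (fun i j hij hj => succMin_mono h hb (by omega) (by omega))
  have hsq : √(esym (m + 1) m fun i => ((l i)⁻¹) ^ 2) ≤ √((m + 1 : ℕ) : ℝ) * P⁻¹ := by
    refine (Real.sqrt_le_sqrt he).trans (le_of_eq ?_)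
    rw [Real.sqrt_mul (by positivity), Finset.prod_inv_distrib, Real.sqrt_sq (by positivity)]
    push_cast; rfl
  have hr : 0 < √((m + 1 : ℕ) : ℝ) := Real.sqrt_pos.2 (by positivity)
  calc 1 / √((m + 1 : ℕ) : ℝ) * C * √(esym (m + 1) m fun i => ((l i)⁻¹) ^ 2)
      ≤ 1 / √((m + 1 : ℕ) : ℝ) * C * (√((m + 1 : ℕ) : ℝ) * P⁻¹) := by gcongr
    _ = C * P⁻¹ := by field_simp
    _ ≤ S / D := by
      rw [le_div_iff₀ hD, mul_right_comm, ← div_eq_mul_inv, div_le_iff₀ hPp]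
      exact hmain

end Paper
end
end
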